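/- arXiv:1004.4873 — 3 statements merged into one kernel-verified Lean document; each statement's English description precedes it below -/
import Mathlib

section
/- Let D ⊆ ℝⁿ be open, let b : D → ℝⁿ be C¹ with globally defined flow ψ, and let x ∈ D satisfy b(x) = 0 and the condition that every eigenvalue of the complexification of the Jacobian matrix of b at x has negative real part. Let B_s := {w ∈ D : ψ(w,t) → x as t → ∞} be the basin of attraction of x and define f_s(w) := ∫₀^∞ |b(ψ(w,t))| dt for w ∈ B_s. Then: (a) f_s is finite-valued and continuous on B_s; (b) f_s is C¹ on B_s \ {x} and ⟨∇f_s(w), b(w)⟩ = −|b(w)| for every w ∈ B_s \ {x}; (c) f_s(w) ≥ |w − x| for every w ∈ B_s; (d) for every compact K ⊆ B_s there is a constant C ≥ 1 such that f_s(w) ≤ C·|w − x| for all w ∈ K. -/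
open MeasureTheory Set Filter
open scoped RealInnerProductSpace

abbrev Euc (n : ℕ) := EuclideanSpace ℝ (Fin n)

/-- `ψ` is a globally defined flow of the vector field `b` on `D`. -/
def GeoIsFlow {n : ℕ} (D : Set (Euc n)) (b : Euc n → Euc n)
    (ψ : Euc n → ℝ → Euc n) : Prop :=
  (∀ x ∈ D, ψ x 0 = x) ∧ (∀ x ∈ D, ∀ t : ℝ, ψ x t ∈ D) ∧
    (∀ x ∈ D, ∀ t : ℝ, HasDerivAt (ψ x) (b (ψ x t)) t)

open scoped Topology NNReal ENNReal

/-- In a complex Banach algebra, powers of an element of spectral radius less than one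
tend to zero. -/
lemma tendsto_pow_zero_of_spectrum_norm_lt_one {𝒜 : Type*} [NormedRing 𝒜] [NormedAlgebra ℂ 𝒜]
    [CompleteSpace 𝒜] {c : 𝒜} (hc : ∀ z ∈ spectrum ℂ c, ‖z‖ < 1) :
    Tendsto (fun k : ℕ => c ^ k) atTop (𝓝 0) := by
  rcases subsingleton_or_nontrivial 𝒜 with h | h
  · exact tendsto_const_nhds.congr fun k => Subsingleton.elim _ _
  have hr : spectralRadius ℂ c < ((1 : ℝ≥0) : ℝ≥0∞) :=
    spectrum.spectralRadius_lt_of_forall_lt c fun z hz => by exact_mod_cast hc z hz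
  obtain ⟨r, hr1, hr2⟩ := ENNReal.lt_iff_exists_nnreal_btwn.1 hr
  have hr2 : r < 1 := by exact_mod_cast hr2
  have hev := (spectrum.pow_nnnorm_pow_one_div_tendsto_nhds_spectralRadius c).eventually
    (gt_mem_nhds hr1)
  refine squeeze_zero_norm' (a := fun k : ℕ => (r : ℝ) ^ k) ?_
    (tendsto_pow_atTop_nhds_zero_of_lt_one r.2 (by exact_mod_cast hr2))
  filter_upwards [hev, eventually_gt_atTop 0] with k hk hk0
  have h1 : (‖c ^ k‖₊ : ℝ≥0∞) ≤ (r : ℝ≥0∞) ^ k := by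
    have h2 := ENNReal.rpow_le_rpow hk.le (Nat.cast_nonneg (α := ℝ) k)
    rwa [← ENNReal.rpow_mul, one_div, inv_mul_cancel₀ (by positivity), ENNReal.rpow_one,
      ENNReal.rpow_natCast] at h2
  have h3 : ‖c ^ k‖₊ ≤ r ^ k := by exact_mod_cast h1
  exact_mod_cast h3

/-- The Cayley transform of an element with spectrum in the open left half-plane has spectrum
in the open unit disc. -/
lemma spectrum_cayley_norm_lt_one {𝒜 : Type*} [Ring 𝒜] [Algebra ℂ 𝒜] {a c : 𝒜}
    (ha : ∀ μ ∈ spectrum ℂ a, μ.re < 0) (hc : c * (1 - a) = 1 + a) :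
    ∀ z ∈ spectrum ℂ c, ‖z‖ < 1 := by
  intro z hz
  by_contra! hz1
  apply hz
  have hu : ∀ μ : ℂ, 0 ≤ μ.re → IsUnit (algebraMap ℂ 𝒜 μ - a) := fun μ hμ => by
    by_contra h
    exact absurd (ha μ h) (not_lt.2 hμ)
  have h1 : IsUnit (1 - a) := by simpa using hu 1 (by simp)
  have h2 : IsUnit ((algebraMap ℂ 𝒜 z - c) * (1 - a)) := by
    have h3 : (algebraMap ℂ 𝒜 z - c) * (1 - a)
        = algebraMap ℂ 𝒜 (z - 1) - algebraMap ℂ 𝒜 (z + 1) * a := by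
      rw [sub_mul, hc]; simp only [map_sub, map_add, map_one]; noncomm_ring
    rw [h3]
    by_cases hz' : z + 1 = 0
    · rw [hz', map_zero, zero_mul, sub_zero]
      refine (IsUnit.mk0 (z - 1) ?_).map (algebraMap ℂ 𝒜)
      intro h; have : (2 : ℂ) = 0 := by linear_combination hz' - h
      norm_num at this
    · have h4 : algebraMap ℂ 𝒜 (z - 1) - algebraMap ℂ 𝒜 (z + 1) * a
          = algebraMap ℂ 𝒜 (z + 1) * (algebraMap ℂ 𝒜 ((z - 1) / (z + 1)) - a) := by
        rw [mul_sub, ← map_mul, mul_div_cancel₀ _ hz']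
      rw [h4]
      refine ((IsUnit.mk0 _ hz').map (algebraMap ℂ 𝒜)).mul (hu _ ?_)
      have h5 : 1 ≤ Complex.normSq z := by
        rw [Complex.normSq_eq_norm_sq]; nlinarith
      rw [Complex.div_re, ← add_div]
      refine div_nonneg ?_ (Complex.normSq_nonneg _)
      rw [Complex.normSq_apply] at h5
      simp; nlinarith
  obtain ⟨u, hu'⟩ := h1
  rw [← hu'] at h2
  have h6 := h2.mul u⁻¹.isUnit
  rwa [mul_assoc, Units.mul_inv, mul_one] at h6

lemma exists_cayley_pow_norm_le {n : ℕ} (A : Euc n →L[ℝ] Euc n)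
    (hspec : ∀ μ ∈ spectrum ℂ
      ((LinearMap.toMatrix (EuclideanSpace.basisFun (Fin n) ℝ).toBasis
          (EuclideanSpace.basisFun (Fin n) ℝ).toBasis A.toLinearMap).map
        Complex.ofReal), μ.re < 0) :
    ∃ C R : Euc n →L[ℝ] Euc n, R * (1 - A) = 1 ∧ C * (1 - A) = 1 + A ∧
      ∃ N : ℕ, 0 < N ∧ ‖C ^ N‖ ≤ 1 / 2 := by
  set M := LinearMap.toMatrix (EuclideanSpace.basisFun (Fin n) ℝ).toBasis
          (EuclideanSpace.basisFun (Fin n) ℝ).toBasis A.toLinearMap with hM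
  let Φ := Matrix.toEuclideanCLM (n := Fin n) (𝕜 := ℝ)
  have hΦM : Φ M = A := by
    ext1 v
    simp [Φ, Matrix.toEuclideanCLM, hM]
  let φ : Matrix (Fin n) (Fin n) ℝ →+* Matrix (Fin n) (Fin n) ℂ := Complex.ofRealHom.mapMatrix
  have hφ : ∀ B, φ B = B.map Complex.ofReal := fun B => rfl
  rw [← hφ] at hspec
  have hdet : IsUnit (1 - M) := by
    have h1 : IsUnit (1 - φ M) := by
      by_contra h
      have := hspec 1 (by simpa [spectrum.mem_iff] using h)
      norm_num at this
    rw [Matrix.isUnit_iff_isUnit_det] at h1 ⊢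
    rw [← map_one φ, ← map_sub, ← RingHom.map_det] at h1
    simpa using h1
  obtain ⟨u, hu⟩ := hdet
  let _ : NormedRing (Matrix (Fin n) (Fin n) ℂ) := Matrix.linftyOpNormedRing
  let _ : NormedAlgebra ℂ (Matrix (Fin n) (Fin n) ℂ) := Matrix.linftyOpNormedAlgebra
  have hlim : Tendsto (fun k : ℕ => (φ ((1 + M) * (↑u⁻¹ : Matrix (Fin n) (Fin n) ℝ))) ^ k)
      atTop (𝓝 0) := by
    refine tendsto_pow_zero_of_spectrum_norm_lt_one (spectrum_cayley_norm_lt_one hspec ?_)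
    rw [← map_one φ, ← map_sub, ← map_mul, ← hu, mul_assoc]
    simp
  have hlim' : Tendsto (fun k : ℕ => ((1 + M) * (↑u⁻¹ : Matrix (Fin n) (Fin n) ℝ)) ^ k)
      atTop (𝓝 0) := by
    refine tendsto_pi_nhds.2 fun i => tendsto_pi_nhds.2 fun j => ?_
    have h1 := (tendsto_pi_nhds.1 (tendsto_pi_nhds.1 hlim i) j)
    have h2 := (Complex.continuous_re.tendsto _).comp h1
    refine Tendsto.congr (fun k => ?_) h2
    rw [Function.comp_apply, ← map_pow]
    rfl
  have hcont : Continuous Φ :=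
    LinearMap.continuous_of_finiteDimensional (Φ.toAlgEquiv.toLinearMap)
  have hlim2 := (hcont.tendsto _).comp hlim'
  have hlim3 : Tendsto (fun k : ℕ => ‖Φ ((1 + M) * (↑u⁻¹ : Matrix (Fin n) (Fin n) ℝ)) ^ k‖)
      atTop (𝓝 0) := by
    have := hlim2.norm
    rw [map_zero, norm_zero] at this
    exact this.congr fun k => by simp
  obtain ⟨N, hN, hN0⟩ := ((hlim3.eventually (ge_mem_nhds (show (0 : ℝ) < 1 / 2 by norm_num))).and
    (eventually_gt_atTop 0)).exists
  refine ⟨Φ ((1 + M) * (↑u⁻¹ : Matrix (Fin n) (Fin n) ℝ)), Φ (↑u⁻¹ : Matrix (Fin n) (Fin n) ℝ),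
    ?_, ?_, N, hN0, hN⟩
  · rw [← hΦM, ← map_one Φ, ← map_sub, ← map_mul, ← hu]; simp
  · rw [← hΦM, ← map_one Φ, ← map_sub, ← map_mul, ← hu, mul_assoc]; simp

/-- **Lyapunov's theorem**: a matrix whose eigenvalues have negative real part is dissipative for
some inner product. -/
lemma exists_lyapunov {n : ℕ} (A : Euc n →L[ℝ] Euc n)
    (hspec : ∀ μ ∈ spectrum ℂ
      ((LinearMap.toMatrix (EuclideanSpace.basisFun (Fin n) ℝ).toBasis
          (EuclideanSpace.basisFun (Fin n) ℝ).toBasis A.toLinearMap).map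
        Complex.ofReal), μ.re < 0) :
    ∃ P : Euc n →L[ℝ] Euc n, (∀ u v, ⟪P u, v⟫ = ⟪P v, u⟫) ∧ (∀ v, ‖v‖ ^ 2 ≤ ⟪P v, v⟫) ∧
      ∃ c > 0, ∀ v, ⟪P v, A v⟫ ≤ -c * ‖v‖ ^ 2 := by
  obtain ⟨C, R, hR, hC, N, hN, hCN⟩ := exists_cayley_pow_norm_le A hspec
  let P : Euc n →L[ℝ] Euc n :=
    ∑ k ∈ Finset.range N, (ContinuousLinearMap.adjoint (C ^ k)) * (C ^ k)
  have hP : ∀ u v, ⟪P u, v⟫ = ∑ k ∈ Finset.range N, ⟪(C ^ k) u, (C ^ k) v⟫ := fun u v => by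
    simp [P, sum_inner, ContinuousLinearMap.adjoint_inner_left]
  have hsymm : ∀ u v, ⟪P u, v⟫ = ⟪P v, u⟫ := fun u v => by
    rw [hP, hP]; exact Finset.sum_congr rfl fun k _ => real_inner_comm _ _
  have hstep : ∀ u, ⟪P (C u), C u⟫ = ⟪P u, u⟫ + (‖(C ^ N) u‖ ^ 2 - ‖u‖ ^ 2) := fun u => by
    rw [hP, hP]
    have := Finset.sum_range_sub (fun k => ⟪(C ^ k) u, (C ^ k) u⟫) N
    rw [Finset.sum_sub_distrib] at this
    simp only [pow_succ, mul_apply_eq_comp, real_inner_self_eq_norm_sq, pow_zero,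
      one_apply_eq_self] at this ⊢
    linarith
  refine ⟨P, hsymm, fun v => ?_, (3 / 16) * (1 + ‖R‖ ^ 2)⁻¹, by positivity, fun v => ?_⟩
  · rw [hP]
    calc ‖v‖ ^ 2 = ⟪(C ^ 0) v, (C ^ 0) v⟫ := by simp
      _ ≤ _ := Finset.single_le_sum (f := fun k => ⟪(C ^ k) v, (C ^ k) v⟫)
        (fun k _ => real_inner_self_nonneg) (Finset.mem_range.2 hN)
  · have h1 := hstep (v - A v)
    have h2 : C (v - A v) = v + A v := by
      have := congrArg (fun T : Euc n →L[ℝ] Euc n => T v) hC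
      simpa using this
    have h3 : R (v - A v) = v := by
      have := congrArg (fun T : Euc n →L[ℝ] Euc n => T v) hR
      simpa using this
    rw [h2] at h1
    simp only [map_add, map_sub, inner_add_left, inner_add_right, inner_sub_left,
      inner_sub_right] at h1
    have h4 := hsymm (A v) v
    have h5 : ‖(C ^ N) (v - A v)‖ ≤ 1 / 2 * ‖v - A v‖ :=
      (ContinuousLinearMap.le_opNorm _ _).trans (by gcongr)
    have h6 : ‖v‖ ≤ ‖R‖ * ‖v - A v‖ := by
      conv_lhs => rw [← h3]
      exact R.le_opNorm _
    have h7 : ‖v‖ ^ 2 ≤ (1 + ‖R‖ ^ 2) * ‖v - A v‖ ^ 2 := by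
      have := pow_le_pow_left₀ (norm_nonneg _) h6 2
      nlinarith [sq_nonneg ‖v - A v‖]
    have h8 : (1 + ‖R‖ ^ 2)⁻¹ * ‖v‖ ^ 2 ≤ ‖v - A v‖ ^ 2 := by
      rw [inv_mul_le_iff₀ (by positivity)]; exact h7
    have h9 := pow_le_pow_left₀ (norm_nonneg _) h5 2
    rw [map_sub] at h9
    nlinarith

section Flow

variable {n : ℕ} {D : Set (Euc n)} {b : Euc n → Euc n} {ψ : Euc n → ℝ → Euc n}

lemma eq_of_hasDerivAt_of_contDiffOn (hD : IsOpen D) (hb : ContDiffOn ℝ 1 b D) {f g : ℝ → Euc n}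
    (hf : ∀ t, HasDerivAt f (b (f t)) t) (hfD : ∀ t, f t ∈ D)
    (hg : ∀ t, HasDerivAt g (b (g t)) t) (h0 : f 0 = g 0) : f = g := by
  have hfc : Continuous f := continuous_iff_continuousAt.2 fun t => (hf t).continuousAt
  have hgc : Continuous g := continuous_iff_continuousAt.2 fun t => (hg t).continuousAt
  have hclopen : IsClopen {t | f t = g t} := by
    refine ⟨isClosed_eq hfc hgc, isOpen_iff_mem_nhds.2 fun t ht => ?_⟩
    obtain ⟨K, s, hs, hK⟩ := (hb.contDiffAt (hD.mem_nhds (hfD t))).exists_lipschitzOnWith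
    refine ODE_solution_unique_of_eventually (v := fun _ => b) (s := fun _ => s) (K := K)
      (Eventually.of_forall fun _ => hK) ?_ ?_ ht
    · filter_upwards [hfc.continuousAt.preimage_mem_nhds hs] with u hu using ⟨hf u, hu⟩
    · rw [ht] at hs
      filter_upwards [hgc.continuousAt.preimage_mem_nhds hs] with u hu using ⟨hg u, hu⟩
  have huniv := hclopen.eq_univ ⟨0, h0⟩
  exact funext fun t => (huniv ▸ mem_univ t : t ∈ {t | f t = g t})

lemma GeoIsFlow.add (hψ : GeoIsFlow D b ψ) (hD : IsOpen D) (hb : ContDiffOn ℝ 1 b D)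
    {w : Euc n} (hw : w ∈ D) (s t : ℝ) : ψ (ψ w s) t = ψ w (s + t) := by
  have hs := hψ.2.1 w hw s
  refine congrFun (eq_of_hasDerivAt_of_contDiffOn hD hb (f := ψ (ψ w s))
    (g := fun t => ψ w (s + t)) (hψ.2.2 _ hs) (hψ.2.1 _ hs) (fun t => ?_) ?_) t
  · exact (hψ.2.2 w hw (s + t)).comp_const_add s t
  · simp [hψ.1 _ hs]

lemma GeoIsFlow.eq_of_zero (hψ : GeoIsFlow D b ψ) (hD : IsOpen D) (hb : ContDiffOn ℝ 1 b D)
    {w : Euc n} (hw : w ∈ D) (hbw : b w = 0) (t : ℝ) : ψ w t = w := by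
  refine congrFun (eq_of_hasDerivAt_of_contDiffOn hD hb (f := ψ w)
    (g := fun _ => w) (hψ.2.2 _ hw) (hψ.2.1 _ hw) (fun t => ?_) (hψ.1 w hw)) t
  rw [hbw]; exact hasDerivAt_const t w

lemma GeoIsFlow.continuous (hψ : GeoIsFlow D b ψ) {w : Euc n} (hw : w ∈ D) :
    Continuous (ψ w) :=
  continuous_iff_continuousAt.2 fun t => (hψ.2.2 w hw t).continuousAt

lemma GeoIsFlow.continuous_field (hψ : GeoIsFlow D b ψ) (hb : ContDiffOn ℝ 1 b D)
    {w : Euc n} (hw : w ∈ D) : Continuous fun t => b (ψ w t) :=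
  hb.continuousOn.comp_continuous (hψ.continuous hw) (hψ.2.1 w hw)

/-- First order Taylor expansion of a `C¹` map, uniformly on compact convex sets. -/
lemma exists_uniform_taylor (hD : IsOpen D) (hb : ContDiffOn ℝ 1 b D) {S : Set (Euc n)}
    (hS : IsCompact S) (hSc : Convex ℝ S) (hSD : S ⊆ D) {ε : ℝ} (hε : 0 < ε) :
    ∃ δ > 0, ∀ u ∈ S, ∀ v ∈ S, dist u v < δ → ‖fderiv ℝ b u - fderiv ℝ b v‖ ≤ ε ∧
      ‖b u - b v - fderiv ℝ b v (u - v)‖ ≤ ε * ‖u - v‖ := by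
  have hc : ContinuousOn (fderiv ℝ b) S :=
    (hb.continuousOn_fderiv_of_isOpen hD le_rfl).mono hSD
  obtain ⟨δ, hδ, h⟩ := Metric.uniformContinuousOn_iff.1
    (hS.uniformContinuousOn_of_continuous hc) ε hε
  have h1 : ∀ u ∈ S, ∀ v ∈ S, dist u v < δ → ‖fderiv ℝ b u - fderiv ℝ b v‖ ≤ ε :=
    fun u hu v hv huv => by simpa [dist_eq_norm] using (h u hu v hv huv).le
  refine ⟨δ, hδ, fun u hu v hv huv => ⟨h1 u hu v hv huv, ?_⟩⟩
  refine Convex.norm_image_sub_le_of_norm_hasFDerivWithin_le' (s := S ∩ Metric.ball v δ)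
    (f' := fderiv ℝ b) (fun z hz => ?_) (fun z hz => h1 z hz.1 v hv hz.2)
    (hSc.inter (convex_ball v δ)) ⟨hv, Metric.mem_ball_self hδ⟩ ⟨hu, huv⟩
  exact ((hb.differentiableOn one_ne_zero).differentiableAt
    (hD.mem_nhds (hSD hz.1))).hasFDerivAt.hasFDerivWithinAt

section Tube

variable {S V : Set (Euc n)} {L : ℝ≥0} {τ : ℝ}

lemma GeoIsFlow.dist_le (hψ : GeoIsFlow D b ψ) (hVD : V ⊆ D) (hL : LipschitzOnWith L b S)
    (hVS : ∀ w ∈ V, ∀ t ∈ Icc 0 τ, ψ w t ∈ S) {w w' : Euc n} (hw : w ∈ V) (hw' : w' ∈ V)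
    {t : ℝ} (ht : t ∈ Icc 0 τ) :
    dist (ψ w t) (ψ w' t) ≤ Real.exp (L * τ) * dist w w' := by
  have h := dist_le_of_trajectories_ODE_of_mem (v := fun _ => b) (s := fun _ => S) (K := L)
    (f := ψ w) (g := ψ w') (a := 0) (b := τ) (δ := dist w w') (fun _ _ => hL)
    (hψ.continuous (hVD hw)).continuousOn
    (fun t _ => (hψ.2.2 w (hVD hw) t).hasDerivWithinAt)
    (fun t ht => hVS w hw t (Ico_subset_Icc_self ht))
    (hψ.continuous (hVD hw')).continuousOn
    (fun t _ => (hψ.2.2 w' (hVD hw') t).hasDerivWithinAt)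
    (fun t ht => hVS w' hw' t (Ico_subset_Icc_self ht))
    (by rw [hψ.1 w (hVD hw), hψ.1 w' (hVD hw')]) t ht
  rw [mul_comm]
  refine h.trans ?_
  gcongr
  linarith [ht.2]

/-- Short-time existence for the variational equation. -/
lemma GeoIsFlow.exists_variational (hψ : GeoIsFlow D b ψ) (hD : IsOpen D)
    (hb : ContDiffOn ℝ 1 b D) (hVD : V ⊆ D) (hτ : 0 ≤ τ)
    (hL : ∀ u ∈ S, ‖fderiv ℝ b u‖ ≤ L) (hVS : ∀ w ∈ V, ∀ t ∈ Icc 0 τ, ψ w t ∈ S)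
    (hLτ : 2 * L * τ ≤ 1) {w : Euc n} (hw : w ∈ V) :
    ∃ M : ℝ → (Euc n →L[ℝ] Euc n), M 0 = ContinuousLinearMap.id ℝ (Euc n) ∧
      ∀ t ∈ Icc 0 τ, HasDerivWithinAt M ((fderiv ℝ b (ψ w t)).comp (M t)) (Icc 0 τ) t := by
  have hpl : IsPicardLindelof (fun t (M : Euc n →L[ℝ] Euc n) => (fderiv ℝ b (ψ w t)).comp M)
      (tmin := 0) (tmax := τ) ⟨0, le_rfl, hτ⟩ (ContinuousLinearMap.id ℝ (Euc n)) 1 0 (2 * L) L := by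
    refine ⟨fun t ht => ?_, fun M _ => ?_, fun t ht M hM => ?_, ?_⟩
    · refine LipschitzOnWith.of_dist_le_mul fun M _ M' _ => ?_
      rw [dist_eq_norm, dist_eq_norm, ← ContinuousLinearMap.comp_sub]
      refine (ContinuousLinearMap.opNorm_comp_le _ _).trans ?_
      gcongr
      exact hL _ (hVS w hw t ht)
    · have hc : Continuous fun t => fderiv ℝ b (ψ w t) :=
        (hb.continuousOn_fderiv_of_isOpen hD le_rfl).comp_continuous
          (hψ.continuous (hVD hw)) (hψ.2.1 w (hVD hw))
      exact (hc.clm_comp continuous_const).continuousOn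
    · have h1 : ‖M‖ ≤ 2 := by
        have h2 : ‖M - ContinuousLinearMap.id ℝ (Euc n)‖ ≤ 1 := by
          simpa [dist_eq_norm] using hM
        have h3 : ‖ContinuousLinearMap.id ℝ (Euc n)‖ ≤ 1 := ContinuousLinearMap.norm_id_le
        have := norm_add_le (M - ContinuousLinearMap.id ℝ (Euc n)) (ContinuousLinearMap.id ℝ (Euc n))
        rw [sub_add_cancel] at this
        linarith
      refine (ContinuousLinearMap.opNorm_comp_le _ _).trans ?_
      rw [NNReal.coe_mul, mul_comm]
      exact mul_le_mul h1 (hL _ (hVS w hw t ht)) (norm_nonneg _) (by norm_num)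
    · simpa [hτ] using hLτ
  exact hpl.exists_eq_forall_mem_Icc_hasDerivWithinAt₀

lemma gronwallBound_zero_le (hL1 : 1 ≤ L) {ε t : ℝ} (hε : 0 ≤ ε) (ht : t ≤ τ) :
    gronwallBound 0 L ε t ≤ ε * Real.exp (L * τ) := by
  have hL1' : (1 : ℝ) ≤ L := by exact_mod_cast hL1
  simp only [gronwallBound_of_K_ne_0 (show (L : ℝ) ≠ 0 by positivity), zero_mul, zero_add]
  have h1 : Real.exp (L * t) - 1 ≤ Real.exp (L * τ) := by
    have : Real.exp (L * t) ≤ Real.exp (L * τ) := by gcongr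
    linarith
  calc ε / L * (Real.exp (L * t) - 1) ≤ ε / L * Real.exp (L * τ) := by gcongr
    _ ≤ ε * Real.exp (L * τ) := by gcongr; exact div_le_self hε hL1'

lemma HasDerivWithinAt.Ici_of_Icc {F : Type*} [NormedAddCommGroup F] [NormedSpace ℝ F]
    {f : ℝ → F} {f' : F} {t : ℝ} (h : HasDerivWithinAt f f' (Icc 0 τ) t) (ht : t ∈ Ico 0 τ) :
    HasDerivWithinAt f f' (Ici t) t :=
  h.mono_of_mem_nhdsWithin (mem_of_superset (Icc_mem_nhdsGE ht.2) (Icc_subset_Icc_left ht.1))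

lemma GeoIsFlow.hasFDerivAt_of_variational (hψ : GeoIsFlow D b ψ) (hD : IsOpen D)
    (hb : ContDiffOn ℝ 1 b D) (hVD : V ⊆ D) (hV : IsOpen V)
    (hS : IsCompact S) (hSc : Convex ℝ S) (hSD : S ⊆ D) (hL1 : 1 ≤ L)
    (hL : ∀ u ∈ S, ‖fderiv ℝ b u‖ ≤ L) (hLip : LipschitzOnWith L b S)
    (hVS : ∀ w ∈ V, ∀ t ∈ Icc 0 τ, ψ w t ∈ S) {w : Euc n} (hw : w ∈ V)
    {M : ℝ → (Euc n →L[ℝ] Euc n)} (hM0 : M 0 = ContinuousLinearMap.id ℝ (Euc n))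
    (hM : ∀ t ∈ Icc 0 τ, HasDerivWithinAt M ((fderiv ℝ b (ψ w t)).comp (M t)) (Icc 0 τ) t)
    {t : ℝ} (ht : t ∈ Icc 0 τ) : HasFDerivAt (fun w => ψ w t) (M t) w := by
  rw [hasFDerivAt_iff_isLittleO, Asymptotics.isLittleO_iff]
  intro c hc
  set G := Real.exp (L * τ) with hG
  have hG0 : 0 < G := Real.exp_pos _
  obtain ⟨δ, hδ, hT⟩ := exists_uniform_taylor hD hb hS hSc hSD (ε := c / (G * G)) (by positivity)
  filter_upwards [hV.mem_nhds hw, Metric.ball_mem_nhds w (show 0 < δ / G by positivity)]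
    with w' hw' hd
  have hdist : ∀ s ∈ Icc 0 τ, dist (ψ w' s) (ψ w s) ≤ G * dist w' w := fun s hs =>
    hψ.dist_le hVD hLip hVS hw' hw hs
  have hlt : G * dist w' w < δ := by
    rw [Metric.mem_ball, lt_div_iff₀ hG0] at hd
    linarith
  have key := dist_le_of_approx_trajectories_ODE (v := fun s z => fderiv ℝ b (ψ w (max 0 (min s τ))) z)
    (K := L) (a := 0) (b := τ) (f := fun s => ψ w' s - ψ w s) (g := fun s => M s (w' - w))
    (f' := fun s => b (ψ w' s) - b (ψ w s))
    (g' := fun s => fderiv ℝ b (ψ w s) (M s (w' - w))) (δ := 0)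
    (εf := c / (G * G) * (G * dist w' w)) (εg := 0) ?_ ?_ ?_ ?_ ?_ ?_ ?_ ?_ t ht
  · rw [dist_eq_norm, add_zero, sub_zero] at key
    refine key.trans ((gronwallBound_zero_le hL1 (by positivity) ht.2).trans_eq ?_)
    rw [← hG, dist_eq_norm]; field_simp
  · intro s
    have hτ : 0 ≤ τ := ht.1.trans ht.2
    refine LipschitzWith.of_dist_le_mul fun z z' => ?_
    rw [dist_eq_norm, dist_eq_norm, ← map_sub]
    exact (fderiv ℝ b _).le_of_opNorm_le
      (hL _ (hVS w hw _ ⟨le_max_left _ _, max_le hτ (min_le_right _ _)⟩)) _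
  · exact ((hψ.continuous (hVD hw')).sub (hψ.continuous (hVD hw))).continuousOn
  · exact fun s _ => ((hψ.2.2 w' (hVD hw') s).sub (hψ.2.2 w (hVD hw) s)).hasDerivWithinAt
  · intro s hs
    have hs' := Ico_subset_Icc_self hs
    simp only [min_eq_left hs.2.le, max_eq_right hs.1]
    rw [dist_eq_norm]
    refine (hT _ (hVS w' hw' s hs') _ (hVS w hw s hs') ((hdist s hs').trans_lt hlt)).2.trans ?_
    rw [← dist_eq_norm]
    gcongr
    exact hdist s hs'
  · intro s hs
    exact ((hM s hs).continuousWithinAt).clm_apply continuousWithinAt_const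
  · intro s hs
    have := ((hM s (Ico_subset_Icc_self hs)).Ici_of_Icc hs).clm_apply
      (hasDerivWithinAt_const s _ (w' - w))
    simpa using this
  · intro s hs
    simp [min_eq_left hs.2.le, max_eq_right hs.1]
  · simp [hM0, hψ.1 w (hVD hw), hψ.1 w' (hVD hw')]

lemma GeoIsFlow.continuousAt_variational (hψ : GeoIsFlow D b ψ) (hD : IsOpen D)
    (hb : ContDiffOn ℝ 1 b D) (hVD : V ⊆ D) (hV : IsOpen V)
    (hS : IsCompact S) (hSc : Convex ℝ S) (hSD : S ⊆ D) (hL1 : 1 ≤ L)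
    (hL : ∀ u ∈ S, ‖fderiv ℝ b u‖ ≤ L) (hLip : LipschitzOnWith L b S)
    (hVS : ∀ w ∈ V, ∀ t ∈ Icc 0 τ, ψ w t ∈ S) {w : Euc n} (hw : w ∈ V)
    {M : Euc n → ℝ → (Euc n →L[ℝ] Euc n)}
    (hM0 : ∀ w ∈ V, M w 0 = ContinuousLinearMap.id ℝ (Euc n))
    (hM : ∀ w ∈ V, ∀ t ∈ Icc 0 τ,
      HasDerivWithinAt (M w) ((fderiv ℝ b (ψ w t)).comp (M w t)) (Icc 0 τ) t)
    {t : ℝ} (ht : t ∈ Icc 0 τ) : ContinuousAt (fun w => M w t) w := by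
  set G := Real.exp (L * τ) with hG
  have hG0 : 0 < G := Real.exp_pos _
  have hMc : ContinuousOn (M w) (Icc 0 τ) := fun s hs => (hM w hw s hs).continuousWithinAt
  obtain ⟨R, hR⟩ := isCompact_Icc.exists_bound_of_continuousOn hMc
  have hR0 : 0 ≤ R := (norm_nonneg _).trans (hR t ht)
  rw [Metric.continuousAt_iff']
  intro c hc
  obtain ⟨δ, hδ, hT⟩ := exists_uniform_taylor hD hb hS hSc hSD (ε := c / ((R + 1) * G))
    (by positivity)
  filter_upwards [hV.mem_nhds hw, Metric.ball_mem_nhds w (show 0 < δ / G by positivity)]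
    with w' hw' hd
  have hdist : ∀ s ∈ Icc 0 τ, dist (ψ w s) (ψ w' s) < δ := fun s hs => by
    refine (hψ.dist_le hVD hLip hVS hw hw' hs).trans_lt ?_
    rw [Metric.mem_ball, lt_div_iff₀ hG0, dist_comm] at hd
    linarith
  have key := dist_le_of_approx_trajectories_ODE
    (v := fun s (Z : Euc n →L[ℝ] Euc n) => (fderiv ℝ b (ψ w' (max 0 (min s τ)))).comp Z)
    (K := L) (a := 0) (b := τ) (f := M w') (g := M w)
    (f' := fun s => (fderiv ℝ b (ψ w' s)).comp (M w' s))
    (g' := fun s => (fderiv ℝ b (ψ w s)).comp (M w s)) (δ := 0)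
    (εf := 0) (εg := c / ((R + 1) * G) * R) ?_ ?_ ?_ ?_ ?_ ?_ ?_ ?_ t ht
  · rw [zero_add, sub_zero] at key
    refine key.trans_lt ((gronwallBound_zero_le hL1 (by positivity) ht.2).trans_lt ?_)
    rw [← hG]
    have : c / ((R + 1) * G) * R * G = c * (R / (R + 1)) := by field_simp
    rw [this]
    refine mul_lt_of_lt_one_right hc ?_
    rw [div_lt_one (by positivity)]; linarith
  · intro s
    have hτ : 0 ≤ τ := ht.1.trans ht.2
    refine LipschitzWith.of_dist_le_mul fun z z' => ?_
    rw [dist_eq_norm, dist_eq_norm, ← ContinuousLinearMap.comp_sub]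
    refine (ContinuousLinearMap.opNorm_comp_le _ _).trans ?_
    gcongr
    exact hL _ (hVS w' hw' _ ⟨le_max_left _ _, max_le hτ (min_le_right _ _)⟩)
  · exact fun s hs => (hM w' hw' s hs).continuousWithinAt
  · exact fun s hs => (hM w' hw' s (Ico_subset_Icc_self hs)).Ici_of_Icc hs
  · intro s hs
    simp [min_eq_left hs.2.le, max_eq_right hs.1]
  · exact hMc
  · exact fun s hs => (hM w hw s (Ico_subset_Icc_self hs)).Ici_of_Icc hs
  · intro s hs
    have hs' := Ico_subset_Icc_self hs
    simp only [min_eq_left hs.2.le, max_eq_right hs.1]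
    rw [dist_eq_norm, ← ContinuousLinearMap.sub_comp]
    refine (ContinuousLinearMap.opNorm_comp_le _ _).trans ?_
    gcongr
    · exact (hT _ (hVS w hw s hs') _ (hVS w' hw' s hs') (hdist s hs')).1
    · exact hR s hs'
  · simp [hM0 w hw, hM0 w' hw']

end Tube

/-- The time-`t` maps, `t ∈ [0, T]`, and their compositions with `b` are uniformly Lipschitz near
`q`, and the time-`t` maps are `C¹` at `q`. -/
def FlowRegularAt (b : Euc n → Euc n) (ψ : Euc n → ℝ → Euc n) (T : ℝ) (q : Euc n) : Prop :=
  ∃ V ∈ 𝓝 q, ∃ K : ℝ≥0, ∀ t ∈ Icc 0 T, LipschitzOnWith K (fun w => ψ w t) V ∧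
    LipschitzOnWith K (fun w => b (ψ w t)) V ∧ ContDiffAt ℝ 1 (fun w => ψ w t) q

lemma FlowRegularAt.mono {T T' : ℝ} {q : Euc n} (h : FlowRegularAt b ψ T q) (hT : T' ≤ T) :
    FlowRegularAt b ψ T' q := by
  obtain ⟨V, hV, K, h⟩ := h
  exact ⟨V, hV, K, fun t ht => h t ⟨ht.1, ht.2.trans hT⟩⟩

lemma GeoIsFlow.norm_sub_le_of_bound (hψ : GeoIsFlow D b ψ) {w : Euc n} (hw : w ∈ D) {r B : ℝ}
    (hB : 0 < B) (hbB : ∀ u ∈ Metric.closedBall w r, ‖b u‖ < B) :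
    ∀ t ∈ Icc 0 (r / B), ‖ψ w t - w‖ ≤ B * t := by
  intro t ht
  refine image_norm_le_of_norm_deriv_right_lt_deriv_boundary (f := fun t => ψ w t - w)
    (f' := fun t => b (ψ w t)) (a := 0) (b := r / B) (B := fun t => B * t) (B' := fun _ => B)
    ?_ (fun s _ => ((hψ.2.2 w hw s).sub_const w).hasDerivWithinAt) ?_ ?_ ?_ ht
  · exact ((hψ.continuous hw).sub continuous_const).continuousOn
  · simp [hψ.1 w hw]
  · intro s; simpa using (hasDerivAt_id s).const_mul B
  · intro s hs hs'
    refine hbB _ ?_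
    have : B * s < r := by
      have := hs.2
      rw [lt_div_iff₀ hB] at this
      linarith
    rw [mem_closedBall_iff_norm, hs']
    exact this.le

lemma GeoIsFlow.exists_eventually_flowRegularAt (hψ : GeoIsFlow D b ψ) (hD : IsOpen D)
    (hb : ContDiffOn ℝ 1 b D) {p : Euc n} (hp : p ∈ D) :
    ∃ τ > 0, ∀ᶠ q in 𝓝 p, FlowRegularAt b ψ τ q := by
  obtain ⟨r, hr, hrD⟩ : ∃ r > 0, Metric.closedBall p (2 * r) ⊆ D := by
    obtain ⟨ε, hε, h⟩ := Metric.isOpen_iff.1 hD p hp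
    exact ⟨ε / 4, by positivity, (Metric.closedBall_subset_ball (by linarith)).trans h⟩
  set S := Metric.closedBall p (2 * r) with hSdef
  have hS : IsCompact S := isCompact_closedBall p _
  have hSc : Convex ℝ S := convex_closedBall p _
  obtain ⟨L0, hL0⟩ := hS.exists_bound_of_continuousOn
    ((hb.continuousOn_fderiv_of_isOpen hD le_rfl).mono hrD)
  obtain ⟨B0, hB0⟩ := hS.exists_bound_of_continuousOn (hb.continuousOn.mono hrD)
  set L : ℝ≥0 := max 1 L0.toNNReal with hLdef
  have hL1 : 1 ≤ L := le_max_left _ _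
  have hL1' : (1 : ℝ) ≤ L := by exact_mod_cast hL1
  have hL : ∀ u ∈ S, ‖fderiv ℝ b u‖ ≤ L := fun u hu =>
    (hL0 u hu).trans ((Real.le_coe_toNNReal L0).trans (by exact_mod_cast le_max_right _ _))
  have hLip : LipschitzOnWith L b S := by
    refine hSc.lipschitzOnWith_of_nnnorm_fderiv_le (𝕜 := ℝ) (fun u hu => ?_) (fun u hu => ?_)
    · exact (hb.differentiableOn one_ne_zero).differentiableAt (hD.mem_nhds (hrD hu))
    · exact_mod_cast hL u hu
  set B := |B0| + 1 with hB
  have hBpos : 0 < B := by positivity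
  set τ := min (r / B) (1 / (2 * L)) with hτ
  have hτ0 : 0 < τ := by positivity
  set V := Metric.ball p r with hVdef
  have hVS' : ∀ w ∈ V, Metric.closedBall w r ⊆ S := fun w hw =>
    Metric.closedBall_subset_closedBall' (by have := Metric.mem_ball.1 hw; linarith)
  have hVD : V ⊆ D := fun w hw => hrD (hVS' w hw (Metric.mem_closedBall_self hr.le))
  have hVS : ∀ w ∈ V, ∀ t ∈ Icc 0 τ, ψ w t ∈ S := fun w hw t ht => by
    have ht' : t ≤ r / B := ht.2.trans (min_le_left _ _)
    refine hVS' w hw ?_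
    rw [mem_closedBall_iff_norm]
    refine (hψ.norm_sub_le_of_bound (hVD hw) hBpos (fun u hu => ?_) t ⟨ht.1, ht'⟩).trans ?_
    · exact (hB0 u (hVS' w hw hu)).trans_lt ((le_abs_self _).trans_lt (lt_add_one _))
    · rw [le_div_iff₀ hBpos] at ht'
      linarith
  have hLτ : 2 * L * τ ≤ 1 := by
    have := min_le_right (r / B) (1 / (2 * (L : ℝ)))
    rw [← hτ, le_div_iff₀ (by positivity)] at this
    linarith
  have hM : ∀ w : Euc n, ∃ M : ℝ → (Euc n →L[ℝ] Euc n), w ∈ V →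
      (M 0 = ContinuousLinearMap.id ℝ (Euc n) ∧
      ∀ t ∈ Icc 0 τ, HasDerivWithinAt M ((fderiv ℝ b (ψ w t)).comp (M t)) (Icc 0 τ) t) :=
    fun w => by
      by_cases hw : w ∈ V
      · obtain ⟨M, hM⟩ := hψ.exists_variational hD hb hVD hτ0.le hL hVS hLτ hw
        exact ⟨M, fun _ => hM⟩
      · exact ⟨0, fun h => absurd h hw⟩
  choose M hM using hM
  refine ⟨τ, hτ0, ?_⟩
  filter_upwards [Metric.isOpen_ball.mem_nhds (Metric.mem_ball_self hr)] with q hq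
  have hVo : IsOpen V := Metric.isOpen_ball
  set G : ℝ≥0 := (Real.exp (L * τ)).toNNReal with hG
  have hGc : (G : ℝ) = Real.exp (L * τ) := Real.coe_toNNReal _ (Real.exp_pos _).le
  refine ⟨V, hVo.mem_nhds hq, max G (L * G), fun t ht => ?_⟩
  have hlip : LipschitzOnWith G (fun w => ψ w t) V := LipschitzOnWith.of_dist_le_mul
    fun w hw w' hw' => hGc ▸ hψ.dist_le hVD hLip hVS hw hw' ht
  refine ⟨hlip.weaken (le_max_left _ _), ?_, ?_⟩
  · exact (hLip.comp hlip (fun w hw => hVS w hw t ht)).weaken (le_max_right _ _)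
  · rw [contDiffAt_one_iff]
    refine ⟨fun w => M w t, V, hVo.mem_nhds hq, fun w hw => ?_, fun w hw => ?_⟩
    · exact (hψ.continuousAt_variational hD hb hVD hVo hS hSc hrD hL1 hL hLip hVS hw
        (fun w hw => (hM w hw).1) (fun w hw => (hM w hw).2) ht).continuousWithinAt
    · exact hψ.hasFDerivAt_of_variational hD hb hVD hVo hS hSc hrD hL1 hL hLip hVS hw
        (hM w hw).1 (hM w hw).2 ht

lemma GeoIsFlow.flowRegularAt_add (hψ : GeoIsFlow D b ψ) (hD : IsOpen D)
    (hb : ContDiffOn ℝ 1 b D) {w : Euc n} (hw : w ∈ D) {T s : ℝ} (hT : 0 ≤ T)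
    (h1 : FlowRegularAt b ψ T w) (h2 : FlowRegularAt b ψ s (ψ w T)) :
    FlowRegularAt b ψ (T + s) w := by
  obtain ⟨V1, hV1, K1, h1⟩ := h1
  obtain ⟨V2, hV2, K2, h2⟩ := h2
  have hT' : T ∈ Icc 0 T := ⟨hT, le_rfl⟩
  have hV : V1 ∩ D ∩ (fun w => ψ w T) ⁻¹' V2 ∈ 𝓝 w :=
    inter_mem (inter_mem hV1 (hD.mem_nhds hw)) ((h1 T hT').2.2.continuousAt.preimage_mem_nhds hV2)
  refine ⟨_, hV, max K1 (K2 * K1), fun t ht => ?_⟩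
  rcases le_total t T with htT | htT
  · obtain ⟨ha, hb', hc⟩ := h1 t ⟨ht.1, htT⟩
    exact ⟨(ha.mono fun _ h => h.1.1).weaken (le_max_left _ _),
      (hb'.mono fun _ h => h.1.1).weaken (le_max_left _ _), hc⟩
  · obtain ⟨ha, hb', hc⟩ := h2 (t - T) ⟨by linarith, by linarith [ht.2]⟩
    have hadd : ∀ u ∈ D, ψ u t = ψ (ψ u T) (t - T) := fun u hu => by
      rw [hψ.add hD hb hu, add_sub_cancel]
    have hTl := (h1 T hT').1.mono (t := V1) (s := V1 ∩ D ∩ (fun w => ψ w T) ⁻¹' V2)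
      (fun _ h => h.1.1)
    refine ⟨?_, ?_, ?_⟩
    · refine LipschitzOnWith.weaken ?_ (le_max_right _ _)
      intro u hu v hv
      simp only [hadd u hu.1.2, hadd v hv.1.2]
      exact (ha.comp hTl fun _ h => h.2) hu hv
    · refine LipschitzOnWith.weaken ?_ (le_max_right _ _)
      intro u hu v hv
      simp only [hadd u hu.1.2, hadd v hv.1.2]
      exact (hb'.comp hTl fun _ h => h.2) hu hv
    · refine (hc.comp w (h1 T hT').2.2).congr_of_eventuallyEq ?_
      filter_upwards [hD.mem_nhds hw] with u hu using hadd u hu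

/-- The time-`t` maps of the flow of a `C¹` vector field are `C¹` and locally Lipschitz, locally
uniformly in `t ≥ 0`. -/
theorem GeoIsFlow.flowRegularAt (hψ : GeoIsFlow D b ψ) (hD : IsOpen D)
    (hb : ContDiffOn ℝ 1 b D) {w : Euc n} (hw : w ∈ D) {T : ℝ} (hT : 0 ≤ T) :
    FlowRegularAt b ψ T w := by
  obtain ⟨τ, hτ, h⟩ : ∃ τ > 0, ∀ q ∈ ψ w '' Icc 0 T, FlowRegularAt b ψ τ q := by
    refine (isCompact_Icc.image (hψ.continuous hw)).induction_on
      (p := fun s => ∃ τ > 0, ∀ q ∈ s, FlowRegularAt b ψ τ q) ⟨1, one_pos, by simp⟩ ?_ ?_ ?_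
    · rintro s t hst ⟨τ, hτ, h⟩
      exact ⟨τ, hτ, fun q hq => h q (hst hq)⟩
    · rintro s t ⟨τ, hτ, h⟩ ⟨τ', hτ', h'⟩
      exact ⟨min τ τ', lt_min hτ hτ', fun q hq => hq.elim
        (fun hq => (h q hq).mono (min_le_left _ _)) fun hq => (h' q hq).mono (min_le_right _ _)⟩
    · rintro _ ⟨t, -, rfl⟩
      obtain ⟨τ, hτ, h⟩ := hψ.exists_eventually_flowRegularAt hD hb (hψ.2.1 w hw t)
      exact ⟨_, mem_nhdsWithin_of_mem_nhds h, τ, hτ, fun q hq => hq⟩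
  have hstep : ∀ k : ℕ, FlowRegularAt b ψ (min T (k * τ)) w := by
    intro k
    induction k with
    | zero =>
      refine (h w ⟨0, ⟨le_rfl, hT⟩, hψ.1 w hw⟩).mono ?_
      simp [hT, hτ.le]
    | succ k ih =>
      have h0 : 0 ≤ min T (k * τ) := le_min hT (by positivity)
      refine (hψ.flowRegularAt_add hD hb hw h0 ih
        (h _ ⟨_, ⟨h0, min_le_left _ _⟩, rfl⟩)).mono ?_
      push_cast
      rw [← min_add_add_right]
      refine le_min ((min_le_left _ _).trans (by linarith)) ((min_le_right _ _).trans (by linarith))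
  obtain ⟨k, hk⟩ := exists_nat_ge (T / τ)
  rw [div_le_iff₀ hτ] at hk
  simpa [min_eq_left hk] using hstep k

lemma GeoIsFlow.contDiffAt (hψ : GeoIsFlow D b ψ) (hD : IsOpen D)
    (hb : ContDiffOn ℝ 1 b D) {w : Euc n} (hw : w ∈ D) {t : ℝ} (ht : 0 ≤ t) :
    ContDiffAt ℝ 1 (fun w => ψ w t) w := by
  obtain ⟨V, hV, K, h⟩ := hψ.flowRegularAt hD hb hw ht
  exact (h t ⟨ht, le_rfl⟩).2.2

/-- Trajectories starting in `U` approach each other exponentially fast, and so do the values of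
`b` along them. -/
def ContractsOn (b : Euc n → Euc n) (ψ : Euc n → ℝ → Euc n) (U : Set (Euc n)) : Prop :=
  ∃ K ≥ (0 : ℝ), ∃ γ > 0, ∀ w ∈ U, ∀ w' ∈ U, ∀ t ≥ 0,
    ‖ψ w t - ψ w' t‖ ≤ K * Real.exp (-γ * t) * ‖w - w'‖ ∧
    ‖b (ψ w t) - b (ψ w' t)‖ ≤ K * Real.exp (-γ * t) * ‖w - w'‖

lemma hasDerivAt_quadratic {P : Euc n →L[ℝ] Euc n} (hP : ∀ u v, ⟪P u, v⟫ = ⟪P v, u⟫)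
    {y : ℝ → Euc n} {y' : Euc n} {t : ℝ} (hy : HasDerivAt y y' t) :
    HasDerivAt (fun t => ⟪P (y t), y t⟫) (2 * ⟪P (y t), y'⟫) t := by
  have h := (P.hasFDerivAt.comp_hasDerivAt t hy).inner ℝ hy
  refine h.congr_deriv ?_
  simp only [Function.comp_apply]
  rw [hP y' (y t)]; ring

lemma exists_ball_dissipative (hD : IsOpen D) (hb : ContDiffOn ℝ 1 b D) {x : Euc n} (hx : x ∈ D)
    {A : Euc n →L[ℝ] Euc n} (hA : HasFDerivAt b A x) {P : Euc n →L[ℝ] Euc n} {c : ℝ} (hc : 0 < c)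
    (hPA : ∀ v, ⟪P v, A v⟫ ≤ -c * ‖v‖ ^ 2) :
    ∃ r > 0, Metric.ball x r ⊆ D ∧ (∃ L : ℝ≥0, LipschitzOnWith L b (Metric.ball x r)) ∧
      ∃ γ > 0, ∀ p ∈ Metric.ball x r, ∀ q ∈ Metric.ball x r,
        ⟪P (p - q), b p - b q⟫ ≤ -γ * ⟪P (p - q), p - q⟫ := by
  have hcd := hb.contDiffAt (hD.mem_nhds hx)
  have hstrict : HasStrictFDerivAt b A x := hcd.hasStrictFDerivAt' hA one_ne_zero
  obtain ⟨L, s, hs, hL⟩ := hcd.exists_lipschitzOnWith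
  have ho := Asymptotics.isLittleO_iff.1 hstrict.isLittleO
    (show 0 < c / (2 * (‖P‖ + 1)) by positivity)
  rw [nhds_prod_eq, eventually_prod_self_iff'] at ho
  obtain ⟨u, hu, ho⟩ := ho
  obtain ⟨r, hr, hball⟩ := Metric.mem_nhds_iff.1 (inter_mem (inter_mem hu hs) (hD.mem_nhds hx))
  rw [subset_inter_iff, subset_inter_iff] at hball
  obtain ⟨⟨hbu, hbs⟩, hbD⟩ := hball
  have hγ : 0 < c / (2 * (‖P‖ + 1)) := by positivity
  refine ⟨r, hr, hbD, ⟨L, hL.mono hbs⟩, _, hγ, fun p hp q hq => ?_⟩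
  have h1 : ‖b p - b q - A (p - q)‖ ≤ c / (2 * (‖P‖ + 1)) * ‖p - q‖ :=
    ho p (hbu hp) q (hbu hq)
  generalize p - q = y at h1 ⊢
  obtain ⟨R, h2⟩ : ∃ R, b p - b q = A y + R := ⟨b p - b q - A y, by abel⟩
  rw [h2, add_sub_cancel_left] at h1
  have h3 : ⟪P y, R⟫ ≤ ‖P‖ * ‖y‖ * (c / (2 * (‖P‖ + 1)) * ‖y‖) :=
    (real_inner_le_norm _ _).trans (mul_le_mul (P.le_opNorm y) h1 (norm_nonneg _) (by positivity))
  have h4 : ⟪P y, y⟫ ≤ ‖P‖ * ‖y‖ * ‖y‖ :=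
    (real_inner_le_norm _ _).trans (mul_le_mul_of_nonneg_right (P.le_opNorm y) (norm_nonneg _))
  have h5 : c / (2 * (‖P‖ + 1)) * ⟪P y, y⟫ ≤ c / (2 * (‖P‖ + 1)) * (‖P‖ * ‖y‖ * ‖y‖) := by gcongr
  have h6 : c / (2 * (‖P‖ + 1)) * ‖P‖ ≤ c / 2 := by
    rw [div_mul_eq_mul_div, div_le_div_iff₀ (by positivity) (by positivity)]
    nlinarith [norm_nonneg P]
  have h7 : ‖P‖ * ‖y‖ * (c / (2 * (‖P‖ + 1)) * ‖y‖) ≤ c / 2 * ‖y‖ ^ 2 :=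
    (mul_le_mul_of_nonneg_right h6 (sq_nonneg ‖y‖)).trans_eq' (by ring)
  have h9 : c / (2 * (‖P‖ + 1)) * (‖P‖ * ‖y‖ * ‖y‖) ≤ c / 2 * ‖y‖ ^ 2 :=
    (mul_le_mul_of_nonneg_right h6 (sq_nonneg ‖y‖)).trans_eq' (by ring)
  rw [h2, inner_add_right]
  have h8 := hPA y
  linarith

lemma GeoIsFlow.exists_contractsOn (hψ : GeoIsFlow D b ψ) (hD : IsOpen D)
    (hb : ContDiffOn ℝ 1 b D) {x : Euc n} (hx : x ∈ D) (hbx : b x = 0)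
    {A : Euc n →L[ℝ] Euc n} (hA : HasFDerivAt b A x)
    (hspec : ∀ μ ∈ spectrum ℂ
      ((LinearMap.toMatrix (EuclideanSpace.basisFun (Fin n) ℝ).toBasis
          (EuclideanSpace.basisFun (Fin n) ℝ).toBasis A.toLinearMap).map
        Complex.ofReal), μ.re < 0) :
    ∃ U ∈ 𝓝 x, U ⊆ D ∧ ContractsOn b ψ U := by
  obtain ⟨P, hPs, hP1, c, hc, hPA⟩ := exists_lyapunov A hspec
  obtain ⟨r, hr, hrD, ⟨L, hL⟩, γ, hγ, hdiss⟩ := exists_ball_dissipative hD hb hx hA hc hPA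
  have hPnn : ∀ v, 0 ≤ ⟪P v, v⟫ := fun v => (sq_nonneg _).trans (hP1 v)
  set U := {p : Euc n | ⟪P (p - x), p - x⟫ < (r / 2) ^ 2} with hU
  have hball : ∀ p : Euc n, ⟪P (p - x), p - x⟫ ≤ (r / 2) ^ 2 → p ∈ Metric.ball x r := by
    intro p hp
    rw [mem_ball_iff_norm]
    have := abs_le_of_sq_le_sq ((hP1 (p - x)).trans hp) (by positivity)
    rw [abs_norm] at this
    linarith
  have hUo : IsOpen U := isOpen_lt (by fun_prop) continuous_const
  have hxU : x ∈ U := by simp [hU, hr]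
  have hUD : U ⊆ D := fun p hp => hrD (hball p (le_of_lt hp))
  have htrap : ∀ w ∈ U, ∀ t ≥ 0, ψ w t ∈ Metric.ball x r := by
    intro w hw t ht
    refine hball _ ?_
    have hd : ∀ s, HasDerivAt (fun t => ⟪P (ψ w t - x), ψ w t - x⟫)
        (2 * ⟪P (ψ w s - x), b (ψ w s)⟫) s := fun s =>
      hasDerivAt_quadratic hPs ((hψ.2.2 w (hUD hw) s).sub_const x)
    refine image_le_of_deriv_right_lt_deriv_boundary (a := 0) (b := t)
      (B := fun _ => (r / 2) ^ 2) (B' := fun _ => 0)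
      (fun s _ => (hd s).continuousAt.continuousWithinAt) (fun s _ => (hd s).hasDerivWithinAt)
      ?_ (fun s => hasDerivAt_const s _) ?_ ⟨ht, le_rfl⟩
    · rw [hψ.1 w (hUD hw)]
      exact le_of_lt hw
    · intro s _ hs
      have h := hdiss (ψ w s) (hball _ hs.le) x (Metric.mem_ball_self hr)
      rw [hbx, sub_zero, hs] at h
      have : 0 < γ * (r / 2) ^ 2 := by positivity
      linarith
  refine ⟨U, hUo.mem_nhds hxU, hUD, (‖P‖ + 1) * (L + 1), by positivity, γ, hγ,
    fun w hw w' hw' t ht => ?_⟩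
  have hd : ∀ s, HasDerivAt (fun t => ⟪P (ψ w t - ψ w' t), ψ w t - ψ w' t⟫)
      (2 * ⟪P (ψ w s - ψ w' s), b (ψ w s) - b (ψ w' s)⟫) s := fun s =>
    hasDerivAt_quadratic hPs ((hψ.2.2 w (hUD hw) s).sub (hψ.2.2 w' (hUD hw') s))
  have he : ∀ s, HasDerivAt (fun t => Real.exp (2 * γ * t)) (Real.exp (2 * γ * s) * (2 * γ)) s :=
    fun s => by simpa using ((hasDerivAt_id s).const_mul (2 * γ)).exp
  have hanti : AntitoneOn
      (fun t => Real.exp (2 * γ * t) * ⟪P (ψ w t - ψ w' t), ψ w t - ψ w' t⟫) (Ici 0) := by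
    refine antitoneOn_of_deriv_nonpos (convex_Ici 0)
      (fun s _ => ((he s).mul (hd s)).continuousAt.continuousWithinAt)
      (fun s _ => ((he s).mul (hd s)).differentiableAt.differentiableWithinAt) fun s hs => ?_
    rw [interior_Ici] at hs
    have h := hdiss _ (htrap w hw s (le_of_lt hs)) _ (htrap w' hw' s (le_of_lt hs))
    refine ((he s).mul (hd s)).deriv.trans_le ?_
    have h2 : Real.exp (2 * γ * s) * (2 * γ * ⟪P (ψ w s - ψ w' s), ψ w s - ψ w' s⟫
        + 2 * ⟪P (ψ w s - ψ w' s), b (ψ w s) - b (ψ w' s)⟫) ≤ 0 :=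
      mul_nonpos_of_nonneg_of_nonpos (Real.exp_pos _).le (by linarith)
    linarith
  have h1 := hanti (mem_Ici.2 le_rfl) (mem_Ici.2 ht) ht
  simp only [mul_zero, Real.exp_zero, one_mul, hψ.1 w (hUD hw), hψ.1 w' (hUD hw')] at h1
  have h2 : ⟪P (w - w'), w - w'⟫ ≤ ((‖P‖ + 1) * ‖w - w'‖) ^ 2 := by
    have h4 : ⟪P (w - w'), w - w'⟫ ≤ ‖P‖ * ‖w - w'‖ * ‖w - w'‖ :=
      (real_inner_le_norm _ _).trans
        (mul_le_mul_of_nonneg_right (P.le_opNorm _) (norm_nonneg _))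
    nlinarith [sq_nonneg ‖w - w'‖, sq_nonneg ‖P‖, norm_nonneg P,
      mul_nonneg (add_nonneg (sq_nonneg ‖P‖) (norm_nonneg P)) (sq_nonneg ‖w - w'‖)]
  have h3 : ‖ψ w t - ψ w' t‖ ≤ (‖P‖ + 1) * Real.exp (-γ * t) * ‖w - w'‖ := by
    have hE : Real.exp (2 * γ * t) * Real.exp (-γ * t) ^ 2 = 1 := by
      rw [pow_two, ← Real.exp_add, ← Real.exp_add]; simp; ring
    have h5 : Real.exp (2 * γ * t) * ‖ψ w t - ψ w' t‖ ^ 2 ≤ ((‖P‖ + 1) * ‖w - w'‖) ^ 2 :=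
      (mul_le_mul_of_nonneg_left (hP1 _) (Real.exp_pos _).le).trans (h1.trans h2)
    refine (abs_le_of_sq_le_sq ?_ (by positivity)).trans' (le_abs_self _)
    calc ‖ψ w t - ψ w' t‖ ^ 2
        = (Real.exp (2 * γ * t) * ‖ψ w t - ψ w' t‖ ^ 2) * Real.exp (-γ * t) ^ 2 := by
          linear_combination (-‖ψ w t - ψ w' t‖ ^ 2) * hE
      _ ≤ ((‖P‖ + 1) * ‖w - w'‖) ^ 2 * Real.exp (-γ * t) ^ 2 := by gcongr
      _ = _ := by ring
  have h0 : 0 ≤ (‖P‖ + 1) * Real.exp (-γ * t) * ‖w - w'‖ := by positivity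
  have hL0 : (0 : ℝ) ≤ L := L.2
  constructor
  · nlinarith
  · have h6 := hL.norm_sub_le (htrap w hw t ht) (htrap w' hw' t ht)
    have h7 := mul_le_mul_of_nonneg_left h3 hL0
    nlinarith

lemma GeoIsFlow.tendsto_of_contractsOn (hψ : GeoIsFlow D b ψ) (hD : IsOpen D)
    (hb : ContDiffOn ℝ 1 b D) {x : Euc n} (hx : x ∈ D) (hbx : b x = 0) {U : Set (Euc n)}
    (hxU : x ∈ U) (hU : ContractsOn b ψ U) {w : Euc n} (hw : w ∈ U) :
    Tendsto (fun t => ψ w t) atTop (𝓝 x) := by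
  obtain ⟨K, hK, γ, hγ, h⟩ := hU
  rw [tendsto_iff_norm_sub_tendsto_zero]
  have h0 : Tendsto (fun t => K * Real.exp (-γ * t) * ‖w - x‖) atTop (𝓝 0) := by
    have h1 : Tendsto (fun t => Real.exp (-γ * t)) atTop (𝓝 0) :=
      Real.tendsto_exp_atBot.comp (tendsto_id.const_mul_atTop_of_neg (neg_lt_zero.2 hγ))
    simpa using (h1.const_mul K).mul_const ‖w - x‖
  refine squeeze_zero' (Eventually.of_forall fun _ => norm_nonneg _) ?_ h0
  filter_upwards [eventually_ge_atTop 0] with t ht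
  simpa [hψ.eq_of_zero hD hb hx hbx] using (h w hw x hxU t ht).1

/-- The set on which contraction holds can be transported backwards along trajectories. -/
lemma GeoIsFlow.exists_contractsOn_of_tendsto (hψ : GeoIsFlow D b ψ) (hD : IsOpen D)
    (hb : ContDiffOn ℝ 1 b D) {x : Euc n} (hx : x ∈ D) (hbx : b x = 0) {U : Set (Euc n)}
    (hxU : U ∈ 𝓝 x) (hU : ContractsOn b ψ U) {w : Euc n} (hw : w ∈ D)
    (hwx : Tendsto (fun t => ψ w t) atTop (𝓝 x)) :
    ∃ W ∈ 𝓝 w, W ⊆ {w ∈ D | Tendsto (fun t => ψ w t) atTop (𝓝 x)} ∧ ContractsOn b ψ W := by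
  obtain ⟨T, hTU, hT⟩ := ((hwx.eventually (eventually_mem_nhds_iff.2 hxU)).and
    (eventually_ge_atTop 0)).exists
  obtain ⟨V, hV, K₁, hK₁⟩ := hψ.flowRegularAt hD hb hw hT
  have hT' : T ∈ Icc 0 T := ⟨hT, le_rfl⟩
  refine ⟨V ∩ D ∩ (fun w => ψ w T) ⁻¹' U, inter_mem (inter_mem hV (hD.mem_nhds hw))
    ((hK₁ T hT').2.2.continuousAt.preimage_mem_nhds hTU), fun u hu => ⟨hu.1.2, ?_⟩, ?_⟩
  · have h1 := hψ.tendsto_of_contractsOn hD hb hx hbx (mem_of_mem_nhds hxU) hU hu.2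
    refine (h1.comp (tendsto_atTop_add_const_right _ (-T) tendsto_id)).congr fun t => ?_
    simp [hψ.add hD hb hu.1.2]
  · obtain ⟨K, hK, γ, hγ, h⟩ := hU
    refine ⟨K₁ * (K + 1) * Real.exp (γ * T), by positivity, γ, hγ, fun u hu v hv t ht => ?_⟩
    have hE : K₁ * (K + 1) * Real.exp (γ * T) * Real.exp (-γ * t) * ‖u - v‖
        = K₁ * (K + 1) * Real.exp (-γ * (t - T)) * ‖u - v‖ := by
      rw [mul_assoc _ (Real.exp _) (Real.exp _), ← Real.exp_add]; congr 3; ring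
    have hK₁0 : (0 : ℝ) ≤ K₁ := K₁.2
    rw [hE]
    rcases le_total t T with htT | htT
    · obtain ⟨h1, h2, -⟩ := hK₁ t ⟨ht, htT⟩
      have h3 : 1 ≤ Real.exp (-γ * (t - T)) := Real.one_le_exp (by nlinarith)
      have h4 : K₁ * ‖u - v‖ ≤ K₁ * (K + 1) * Real.exp (-γ * (t - T)) * ‖u - v‖ := by
        gcongr
        calc (K₁ : ℝ) = K₁ * 1 * 1 := by ring
          _ ≤ _ := by gcongr; linarith
      exact ⟨(h1.norm_sub_le hu.1.1 hv.1.1).trans h4, (h2.norm_sub_le hu.1.1 hv.1.1).trans h4⟩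
    · have hadd : ∀ u ∈ D, ψ u t = ψ (ψ u T) (t - T) := fun u hu => by
        rw [hψ.add hD hb hu, add_sub_cancel]
      have h1 := (hK₁ T hT').1.norm_sub_le hu.1.1 hv.1.1
      have h2 := h _ hu.2 _ hv.2 (t - T) (by linarith)
      have h4 : K * Real.exp (-γ * (t - T)) * ‖ψ u T - ψ v T‖
          ≤ K₁ * (K + 1) * Real.exp (-γ * (t - T)) * ‖u - v‖ := by
        calc K * Real.exp (-γ * (t - T)) * ‖ψ u T - ψ v T‖
            ≤ (K + 1) * Real.exp (-γ * (t - T)) * (K₁ * ‖u - v‖) := by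
              gcongr; linarith
          _ = _ := by ring
      rw [hadd u hu.1.2, hadd v hv.1.2]
      exact ⟨h2.1.trans h4, h2.2.trans h4⟩

lemma GeoIsFlow.integrableOn_speed (hψ : GeoIsFlow D b ψ) (hD : IsOpen D)
    (hb : ContDiffOn ℝ 1 b D) {x : Euc n} (hx : x ∈ D) (hbx : b x = 0) {U : Set (Euc n)}
    (hxU : U ∈ 𝓝 x) (hU : ContractsOn b ψ U) {w : Euc n} (hw : w ∈ D)
    (hwx : Tendsto (fun t => ψ w t) atTop (𝓝 x)) :
    IntegrableOn (fun t => ‖b (ψ w t)‖) (Ioi 0) := by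
  obtain ⟨T, hTU, hT⟩ := ((hwx.eventually hxU).and (eventually_ge_atTop 0)).exists
  obtain ⟨K, hK, γ, hγ, h⟩ := hU
  refine integrable_of_isBigO_exp_neg hγ (hψ.continuous_field hb hw).norm.continuousOn ?_
  refine Asymptotics.IsBigO.of_bound (K * Real.exp (γ * T) * ‖ψ w T - x‖) ?_
  filter_upwards [eventually_ge_atTop T] with t ht
  have h1 := (h _ hTU x (mem_of_mem_nhds hxU) (t - T) (by linarith)).2
  rw [hψ.add hD hb hw, add_sub_cancel, hψ.eq_of_zero hD hb hx hbx, hbx, sub_zero] at h1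
  rw [norm_norm, Real.norm_of_nonneg (Real.exp_pos _).le]
  refine h1.trans_eq ?_
  have : Real.exp (-γ * (t - T)) = Real.exp (γ * T) * Real.exp (-γ * t) := by
    rw [← Real.exp_add]; congr 1; ring
  rw [this]; ring

/-- The length of the forward trajectory. -/
noncomputable def flowLength (b : Euc n → Euc n) (ψ : Euc n → ℝ → Euc n) (w : Euc n) : ℝ :=
  ∫ t in Ioi (0 : ℝ), ‖b (ψ w t)‖

lemma ContractsOn.lipschitz_flowLength {W : Set (Euc n)} (hW : ContractsOn b ψ W)
    (hint : ∀ w ∈ W, IntegrableOn (fun t => ‖b (ψ w t)‖) (Ioi 0)) :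
    ∃ C : ℝ≥0, LipschitzOnWith C (flowLength b ψ) W := by
  obtain ⟨K, hK, γ, hγ, h⟩ := hW
  have hE : IntegrableOn (fun t => K * Real.exp (-γ * t)) (Ioi 0) :=
    (exp_neg_integrableOn_Ioi 0 hγ).const_mul K
  have hI : 0 ≤ ∫ t in Ioi (0 : ℝ), K * Real.exp (-γ * t) :=
    integral_nonneg fun t => by positivity
  refine ⟨(∫ t in Ioi (0 : ℝ), K * Real.exp (-γ * t)).toNNReal,
    LipschitzOnWith.of_dist_le_mul fun u hu v hv => ?_⟩
  rw [dist_eq_norm, dist_eq_norm, flowLength, flowLength, ← integral_sub (hint u hu) (hint v hv),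
    Real.coe_toNNReal _ hI, ← integral_mul_const]
  refine norm_integral_le_of_norm_le (hE.mul_const _) ?_
  filter_upwards [ae_restrict_mem measurableSet_Ioi] with t ht
  exact (abs_norm_sub_norm_le _ _).trans (h u hu v hv t (le_of_lt ht)).2

lemma GeoIsFlow.norm_sub_le_flowLength (hψ : GeoIsFlow D b ψ) (hb : ContDiffOn ℝ 1 b D)
    {x w : Euc n} (hw : w ∈ D) (hwx : Tendsto (fun t => ψ w t) atTop (𝓝 x))
    (hint : IntegrableOn (fun t => ‖b (ψ w t)‖) (Ioi 0)) : ‖w - x‖ ≤ flowLength b ψ w := by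
  have hlim : Tendsto (fun t => ‖ψ w t - w‖) atTop (𝓝 ‖x - w‖) := (hwx.sub_const w).norm
  rw [norm_sub_rev]
  refine le_of_tendsto hlim ?_
  filter_upwards [eventually_ge_atTop 0] with T hT
  have h1 := intervalIntegral.integral_eq_sub_of_hasDerivAt (a := 0) (b := T)
    (fun t _ => hψ.2.2 w hw t) ((hψ.continuous_field hb hw).intervalIntegrable _ _)
  rw [hψ.1 w hw] at h1
  rw [← h1]
  refine (intervalIntegral.norm_integral_le_integral_norm hT).trans ?_
  rw [intervalIntegral.integral_of_le hT]
  exact setIntegral_mono_set hint (Eventually.of_forall fun _ => norm_nonneg _)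
    (Eventually.of_forall Ioc_subset_Ioi_self)

lemma GeoIsFlow.field_ne_zero (hψ : GeoIsFlow D b ψ) (hD : IsOpen D) (hb : ContDiffOn ℝ 1 b D)
    {x w : Euc n} (hw : w ∈ D) (hwx : Tendsto (fun t => ψ w t) atTop (𝓝 x)) (hne : w ≠ x)
    (t : ℝ) : b (ψ w t) ≠ 0 := by
  intro h
  have h1 := hψ.eq_of_zero hD hb (hψ.2.1 w hw t) h
  have h2 := h1 (-t)
  rw [hψ.add hD hb hw, add_neg_cancel, hψ.1 w hw] at h2
  rw [← h2] at h1
  exact hne (tendsto_nhds_unique (tendsto_const_nhds.congr fun s => (h1 s).symm) hwx)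

lemma GeoIsFlow.contDiffAt_speed (hψ : GeoIsFlow D b ψ) (hD : IsOpen D)
    (hb : ContDiffOn ℝ 1 b D) {w : Euc n} (hw : w ∈ D) {t : ℝ} (ht : 0 ≤ t)
    (hne : b (ψ w t) ≠ 0) : ContDiffAt ℝ 1 (fun w => ‖b (ψ w t)‖) w :=
  ((hb.contDiffAt (hD.mem_nhds (hψ.2.1 w hw t))).comp w (hψ.contDiffAt hD hb hw ht)).norm ℝ hne

/-- A parametrised derivative is measurable in the parameter. -/
lemma aestronglyMeasurable_fderiv_param {F : Euc n → ℝ → ℝ} {F' : ℝ → (Euc n →L[ℝ] ℝ)}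
    {μ : Measure ℝ} {w : Euc n} (hF : ∀ᶠ u in 𝓝 w, AEStronglyMeasurable (F u) μ)
    (hF' : ∀ᵐ t ∂μ, HasFDerivAt (fun u => F u t) (F' t) w) : AEStronglyMeasurable F' μ := by
  have happ : ∀ v, AEStronglyMeasurable (fun t => F' t v) μ := by
    intro v
    have h1 : Tendsto (fun k : ℕ => w + ((k : ℝ))⁻¹ • v) atTop (𝓝 w) := by
      have := ((tendsto_inv_atTop_nhds_zero_nat (𝕜 := ℝ)).smul_const v).const_add w
      simpa using this
    obtain ⟨N, hN⟩ := eventually_atTop.1 (h1.eventually hF)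
    refine aestronglyMeasurable_of_tendsto_ae atTop
      (f := fun (k : ℕ) t => ((k + N : ℕ) : ℝ) • (F (w + (((k + N : ℕ) : ℝ))⁻¹ • v) t - F w t))
      (fun k => ((hN (k + N) (by omega)).sub hF.self_of_nhds).const_smul
        ((k + N : ℕ) : ℝ)) ?_
    filter_upwards [hF'] with t ht
    refine ht.lim v ?_
    have h2 : Tendsto (fun k : ℕ => ((k + N : ℕ) : ℝ)) atTop atTop :=
      tendsto_natCast_atTop_atTop.comp (tendsto_add_atTop_nat N)
    exact tendsto_norm_atTop_atTop.comp h2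
  have hsum : F' = fun t => ∑ i, (F' t (EuclideanSpace.basisFun (Fin n) ℝ i)) •
      innerSL ℝ (EuclideanSpace.basisFun (Fin n) ℝ i) := by
    ext t v
    conv_lhs => rw [← (EuclideanSpace.basisFun (Fin n) ℝ).sum_repr' v]
    simp [mul_comm]
  rw [hsum]
  exact Finset.aestronglyMeasurable_fun_sum _ fun i _ => (happ _).smul_const _

lemma GeoIsFlow.aestronglyMeasurable_speed (hψ : GeoIsFlow D b ψ) (hb : ContDiffOn ℝ 1 b D)
    {w : Euc n} (hw : w ∈ D) :
    AEStronglyMeasurable (fun t => ‖b (ψ w t)‖) (volume.restrict (Ioi 0)) :=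
  (hψ.continuous_field hb hw).norm.aestronglyMeasurable

lemma GeoIsFlow.contDiffAt_flowLength (hψ : GeoIsFlow D b ψ) (hD : IsOpen D)
    (hb : ContDiffOn ℝ 1 b D) {W : Set (Euc n)} (hW : ContractsOn b ψ W) (hWD : W ⊆ D)
    (hint : ∀ w ∈ W, IntegrableOn (fun t => ‖b (ψ w t)‖) (Ioi 0)) {w : Euc n} (hw : W ∈ 𝓝 w)
    (hne : ∀ᶠ u in 𝓝 w, ∀ t, b (ψ u t) ≠ 0) : ContDiffAt ℝ 1 (flowLength b ψ) w := by
  obtain ⟨K, hK, γ, hγ, h⟩ := hW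
  have hE : IntegrableOn (fun t => K * Real.exp (-γ * t)) (Ioi 0) :=
    (exp_neg_integrableOn_Ioi 0 hγ).const_mul K
  have hlip : ∀ t, 0 ≤ t → LipschitzOnWith (Real.nnabs (K * Real.exp (-γ * t)))
      (fun u => ‖b (ψ u t)‖) W := fun t ht => LipschitzOnWith.of_dist_le_mul fun u hu v hv => by
    rw [Real.coe_nnabs, abs_of_nonneg (by positivity), dist_eq_norm, dist_eq_norm]
    exact (abs_norm_sub_norm_le _ _).trans (h u hu v hv t ht).2
  have hmeas : ∀ u, W ∈ 𝓝 u → ∀ᶠ v in 𝓝 u,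
      AEStronglyMeasurable (fun t => ‖b (ψ v t)‖) (volume.restrict (Ioi 0)) := fun u hu => by
    filter_upwards [hu] with v hv using hψ.aestronglyMeasurable_speed hb (hWD hv)
  have hdiff : ∀ u, W ∈ 𝓝 u → (∀ t, b (ψ u t) ≠ 0) → ∀ᵐ t ∂(volume.restrict (Ioi (0 : ℝ))),
      HasFDerivAt (fun v => ‖b (ψ v t)‖) (fderiv ℝ (fun v => ‖b (ψ v t)‖) u) u :=
    fun u hu hu' => by
      filter_upwards [ae_restrict_mem measurableSet_Ioi] with t ht
      exact ((hψ.contDiffAt_speed hD hb (hWD (mem_of_mem_nhds hu)) (le_of_lt ht)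
        (hu' t)).differentiableAt one_ne_zero).hasFDerivAt
  have hder : ∀ u, W ∈ 𝓝 u → (∀ t, b (ψ u t) ≠ 0) → HasFDerivAt (flowLength b ψ)
      (∫ t in Ioi (0 : ℝ), fderiv ℝ (fun v => ‖b (ψ v t)‖) u) u := fun u hu hu' => by
    refine (hasFDerivAt_integral_of_dominated_loc_of_lip (𝕜 := ℝ) (F := fun v t => ‖b (ψ v t)‖)
      (bound := fun t => K * Real.exp (-γ * t)) hu
      (hmeas u hu) (hint u (mem_of_mem_nhds hu))
      (aestronglyMeasurable_fderiv_param (hmeas u hu) (hdiff u hu hu')) ?_ hE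
      (hdiff u hu hu')).2
    filter_upwards [ae_restrict_mem measurableSet_Ioi] with t ht using hlip t (le_of_lt ht)
  obtain ⟨u, hu, huo, hwu⟩ := mem_nhds_iff.1 ((eventually_mem_nhds_iff.2 hw).and hne)
  rw [contDiffAt_one_iff]
  refine ⟨_, u, huo.mem_nhds hwu, fun z hz => ContinuousAt.continuousWithinAt ?_,
    fun z hz => hder z (hu hz).1 (hu hz).2⟩
  have hz' := huo.mem_nhds hz
  refine continuousAt_of_dominated (bound := fun t => K * Real.exp (-γ * t)) ?_ ?_ hE ?_
  · filter_upwards [hz'] with v hv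
    exact aestronglyMeasurable_fderiv_param (hmeas v (hu hv).1) (hdiff v (hu hv).1 (hu hv).2)
  · filter_upwards [hz'] with v hv
    filter_upwards [ae_restrict_mem measurableSet_Ioi] with t ht
    refine (norm_fderiv_le_of_lipschitzOn ℝ (hu hv).1 (hlip t (le_of_lt ht))).trans_eq ?_
    rw [Real.coe_nnabs, abs_of_nonneg (by positivity)]
  · filter_upwards [ae_restrict_mem measurableSet_Ioi] with t ht
    exact (hψ.contDiffAt_speed hD hb (hWD (mem_of_mem_nhds (hu hz).1)) (le_of_lt ht)
      ((hu hz).2 t)).continuousAt_fderiv one_ne_zero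

lemma GeoIsFlow.fderiv_flowLength_field (hψ : GeoIsFlow D b ψ) (hD : IsOpen D)
    (hb : ContDiffOn ℝ 1 b D) {w : Euc n} (hw : w ∈ D)
    (hint : IntegrableOn (fun t => ‖b (ψ w t)‖) (Ioi 0)) {f' : Euc n →L[ℝ] ℝ}
    (hf : HasFDerivAt (flowLength b ψ) f' w) : f' (b w) = -‖b w‖ := by
  have hcont := (hψ.continuous_field hb hw).norm
  have h1 : HasDerivAt (fun s => flowLength b ψ (ψ w s)) (f' (b w)) 0 := by
    have h := hψ.2.2 w hw 0
    rw [hψ.1 w hw] at h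
    exact HasFDerivAt.comp_hasDerivAt 0 (by rwa [hψ.1 w hw]) h
  have h2 : ∀ s, flowLength b ψ (ψ w s)
      = flowLength b ψ w - ∫ t in (0 : ℝ)..s, ‖b (ψ w t)‖ := fun s => by
    have hs : flowLength b ψ (ψ w s) = ∫ t in Ioi s, ‖b (ψ w t)‖ := by
      have := (measurePreserving_add_left volume s).setIntegral_preimage_emb
        (measurableEmbedding_addLeft s) (fun t => ‖b (ψ w t)‖) (Ioi s)
      simpa [flowLength, hψ.add hD hb hw] using this
    have hi : ∀ a, IntegrableOn (fun t => ‖b (ψ w t)‖) (Ioi a) := fun a => by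
      refine IntegrableOn.mono_set (t := Ioc a 0 ∪ Ioi 0)
        (IntegrableOn.union ((hcont.integrableOn_Icc).mono_set Ioc_subset_Icc_self) hint) ?_
      intro t ht
      rcases le_or_gt t 0 with h | h
      · exact Or.inl ⟨ht, h⟩
      · exact Or.inr h
    have := intervalIntegral.integral_Ioi_sub_Ioi' (hi 0) (hi s)
    rw [hs, flowLength, ← this]; ring
  have h3 : HasDerivAt (fun s => flowLength b ψ (ψ w s)) (-‖b w‖) 0 := by
    simp only [h2]
    have h := (intervalIntegral.integral_hasDerivAt_right (hcont.intervalIntegrable 0 0)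
      hcont.aestronglyMeasurable.stronglyMeasurableAtFilter hcont.continuousAt).const_sub
      (flowLength b ψ w)
    rwa [hψ.1 w hw] at h
  exact h1.unique h3

end Flow

/-- properties of the arclength-to-attractor function
`f_s(w) = ∫₀^∞ |b(ψ(w,t))| dt` on the basin of attraction of a stable
equilibrium point `x`. -/
theorem statement9 {n : ℕ} (D : Set (Euc n)) (hD : IsOpen D) (hDne : D.Nonempty)
    (b : Euc n → Euc n) (hb : ContDiffOn ℝ 1 b D)
    (ψ : Euc n → ℝ → Euc n) (hψ : GeoIsFlow D b ψ)
    (x : Euc n) (hx : x ∈ D) (hbx : b x = 0)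
    (A : Euc n →L[ℝ] Euc n) (hA : HasFDerivAt b A x)
    (hspec : ∀ μ ∈ spectrum ℂ
      ((LinearMap.toMatrix (EuclideanSpace.basisFun (Fin n) ℝ).toBasis
          (EuclideanSpace.basisFun (Fin n) ℝ).toBasis A.toLinearMap).map
        Complex.ofReal), μ.re < 0)
    (Bs : Set (Euc n))
    (hBs : Bs = {w ∈ D | Tendsto (fun t => ψ w t) atTop (nhds x)})
    (fs : Euc n → ℝ)
    (hfs : ∀ w, fs w = ∫ t in Set.Ioi (0:ℝ), ‖b (ψ w t)‖) :
    (∀ w ∈ Bs, IntegrableOn (fun t => ‖b (ψ w t)‖) (Set.Ioi 0)) ∧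
    ContinuousOn fs Bs ∧
    (∃ g : Euc n → Euc n, ContinuousOn g (Bs \ {x}) ∧
      ∀ w ∈ Bs \ {x}, HasGradientAt fs (g w) w ∧ ⟪g w, b w⟫ = -‖b w‖) ∧
    (∀ w ∈ Bs, ‖w - x‖ ≤ fs w) ∧
    (∀ K ⊆ Bs, IsCompact K → ∃ C ≥ (1:ℝ), ∀ w ∈ K, fs w ≤ C * ‖w - x‖) := by
  subst hBs
  obtain rfl : fs = flowLength b ψ := funext hfs
  obtain ⟨U, hxU, -, hU⟩ := hψ.exists_contractsOn hD hb hx hbx hA hspec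
  have hint : ∀ w ∈ {w ∈ D | Tendsto (fun t => ψ w t) atTop (𝓝 x)},
      IntegrableOn (fun t => ‖b (ψ w t)‖) (Ioi 0) := fun w hw =>
    hψ.integrableOn_speed hD hb hx hbx hxU hU hw.1 hw.2
  have hloc : ∀ w ∈ {w ∈ D | Tendsto (fun t => ψ w t) atTop (𝓝 x)}, ∃ W ∈ 𝓝 w,
      W ⊆ {w ∈ D | Tendsto (fun t => ψ w t) atTop (𝓝 x)} ∧ ContractsOn b ψ W := fun w hw =>
    hψ.exists_contractsOn_of_tendsto hD hb hx hbx hxU hU hw.1 hw.2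
  have hcont : ContinuousOn (flowLength b ψ)
      {w ∈ D | Tendsto (fun t => ψ w t) atTop (𝓝 x)} := fun w hw => by
    obtain ⟨W, hWw, hWB, hW⟩ := hloc w hw
    obtain ⟨C, hC⟩ := hW.lipschitz_flowLength fun u hu => hint u (hWB hu)
    exact (hC.continuousOn.continuousAt hWw).continuousWithinAt
  have hreg : ∀ w ∈ {w ∈ D | Tendsto (fun t => ψ w t) atTop (𝓝 x)} \ {x},
      ContDiffAt ℝ 1 (flowLength b ψ) w := fun w hw => by
    obtain ⟨W, hWw, hWB, hW⟩ := hloc w hw.1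
    refine hψ.contDiffAt_flowLength hD hb hW (fun u hu => (hWB hu).1)
      (fun u hu => hint u (hWB hu)) hWw ?_
    filter_upwards [hWw, isOpen_ne.mem_nhds hw.2] with u hu hux
    exact hψ.field_ne_zero hD hb (hWB hu).1 (hWB hu).2 hux
  refine ⟨hint, hcont, ⟨gradient (flowLength b ψ), fun w hw => ?_, fun w hw => ⟨?_, ?_⟩⟩,
    fun w hw => hψ.norm_sub_le_flowLength hb hw.1 hw.2 (hint w hw), fun K hK hKc => ?_⟩
  · exact ((InnerProductSpace.toDual ℝ (Euc n)).symm.continuous.continuousAt.comp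
      ((hreg w hw).continuousAt_fderiv one_ne_zero)).continuousWithinAt
  · exact ((hreg w hw).differentiableAt one_ne_zero).hasGradientAt
  · rw [gradient, InnerProductSpace.toDual_symm_apply]
    exact hψ.fderiv_flowLength_field hD hb hw.1.1 (hint w hw.1)
      ((hreg w hw).differentiableAt one_ne_zero).hasFDerivAt
  · have hxB : x ∈ {w ∈ D | Tendsto (fun t => ψ w t) atTop (𝓝 x)} :=
      ⟨hx, hψ.tendsto_of_contractsOn hD hb hx hbx (mem_of_mem_nhds hxU) hU (mem_of_mem_nhds hxU)⟩
    have hfx : flowLength b ψ x = 0 := by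
      simp [flowLength, hψ.eq_of_zero hD hb hx hbx, hbx]
    obtain ⟨W, hWx, hWB, hW⟩ := hloc x hxB
    obtain ⟨C, hC⟩ := hW.lipschitz_flowLength fun u hu => hint u (hWB hu)
    obtain ⟨r, hr, hrW⟩ := Metric.mem_nhds_iff.1 hWx
    obtain ⟨M, hM⟩ := hKc.exists_bound_of_continuousOn (hcont.mono hK)
    have hMr : 0 ≤ |M| / r := by positivity
    have hC0 : (0 : ℝ) ≤ C := C.2
    refine ⟨1 + C + |M| / r, by linarith, fun w hw => ?_⟩
    have hn := norm_nonneg (w - x)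
    rcases lt_or_ge ‖w - x‖ r with h | h
    · have h1 := hC.norm_sub_le (hrW (mem_ball_iff_norm.2 h)) (mem_of_mem_nhds hWx)
      rw [hfx, sub_zero] at h1
      have h2 : (C : ℝ) * ‖w - x‖ ≤ (1 + C + |M| / r) * ‖w - x‖ := by gcongr; linarith
      exact (le_abs_self _).trans (h1.trans h2)
    · calc flowLength b ψ w ≤ |M| := (le_abs_self _).trans ((hM w hw).trans (le_abs_self _))
        _ = |M| / r * r := by field_simp
        _ ≤ (1 + C + |M| / r) * ‖w - x‖ := by gcongr; linarith
end

section
/- Let D ⊆ ℝⁿ be open, let b : D → ℝⁿ be C¹ with globally defined flow ψ, and let M ⊆ D be an admissible manifold of b with witness function f_M. Then for every x ∈ M and every t ∈ ℝ one has sign(f_M(ψ(x,t))) = sign(t); in particular, ψ(x,t) ∈ M if and only if t = 0, so no flowline of b crosses M more than once. -/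
open MeasureTheory Set Filter
open scoped RealInnerProductSpace

/-- `M` is an admissible manifold of `b` with witness function `f`. -/
def GeoIsAdmissibleWith {n : ℕ} (D : Set (Euc n)) (b : Euc n → Euc n)
    (M : Set (Euc n)) (f : Euc n → ℝ) : Prop :=
  ContinuousOn f D ∧ M = {w ∈ D | f w = 0} ∧ IsCompact M ∧
    (∃ U : Set (Euc n), IsOpen U ∧ M ⊆ U ∧ U ⊆ D ∧ ContDiffOn ℝ 1 f U) ∧
    ∀ x ∈ M, 0 < ⟪gradient f x, b x⟫

/-- A continuous real function whose derivative is positive at each of its zeros is positive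
to the right of any zero. -/
theorem pos_of_deriv_pos_at_zeros {g : ℝ → ℝ} (hg : Continuous g)
    (hd : ∀ s, g s = 0 → 0 < deriv g s) {a t : ℝ} (ha : g a = 0) (hat : a < t) : 0 < g t := by
  by_contra! ht
  have hsign : ∀ s, g s = 0 → ∀ᶠ u in nhds s, SignType.sign (g u) = SignType.sign (u - s) :=
    fun s hs => eventually_nhdsWithin_sign_eq_of_deriv_pos (hd s hs) hs
  obtain ⟨e, he, hae, het⟩ : ∃ e, 0 < g e ∧ a < e ∧ e < t := by
    obtain ⟨e, h, hae⟩ := (((hsign a ha).filter_mono nhdsWithin_le_nhds).and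
      (Ioo_mem_nhdsGT hat)).exists
    refine ⟨e, ?_, hae⟩
    rwa [sign_pos (sub_pos.2 hae.1), sign_eq_one_iff] at h
  have hK : IsCompact (Icc e t ∩ {s | g s ≤ 0}) :=
    isCompact_Icc.inter_right (isClosed_le hg continuous_const)
  obtain ⟨s, ⟨⟨hes, hst⟩, hgs⟩, hmin⟩ := hK.exists_isLeast ⟨t, ⟨het.le, le_rfl⟩, ht⟩
  obtain ⟨r, ⟨her, hrs⟩, hr⟩ := intermediate_value_Icc' hes hg.continuousOn ⟨hgs, he.le⟩
  obtain rfl : r = s := le_antisymm hrs (hmin ⟨⟨her, hrs.trans hst⟩, hr.le⟩)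
  have her' : e < r := her.lt_of_ne (by rintro rfl; exact he.ne' hr)
  obtain ⟨u, hu, heu, hur⟩ := (((hsign r hr).filter_mono nhdsWithin_le_nhds).and
    (Ioo_mem_nhdsLT her')).exists
  rw [sign_neg (sub_neg.2 hur), sign_eq_neg_one_iff] at hu
  exact hur.not_ge (hmin ⟨⟨heu.le, hur.le.trans hst⟩, hu.le⟩)

/-- A continuous real function whose derivative is positive at each of its zeros is negative
to the left of any zero. -/
theorem neg_of_deriv_pos_at_zeros {g : ℝ → ℝ} (hg : Continuous g)
    (hd : ∀ s, g s = 0 → 0 < deriv g s) {a t : ℝ} (ha : g a = 0) (hat : t < a) : g t < 0 := by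
  by_contra! h
  rcases h.eq_or_lt with h | h
  · exact (pos_of_deriv_pos_at_zeros hg hd h.symm hat).ne' ha
  · have hd' : ∀ s, -g (-s) = 0 → 0 < deriv (fun s => -g (-s)) s := by
      intro s hs
      have : deriv (fun s => -g (-s)) s = deriv g (-s) := by
        rw [deriv.fun_neg, deriv_comp_neg, neg_neg]
      rw [this]
      exact hd _ (neg_eq_zero.1 hs)
    have := pos_of_deriv_pos_at_zeros (g := fun s => -g (-s)) (by fun_prop) hd'
      (a := -a) (t := -t) (by simpa using ha) (neg_lt_neg hat)
    simp only [neg_neg] at this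
    linarith

/-- The derivative of a function along a curve is the inner product of its gradient with the
velocity of the curve. -/
theorem hasDerivAt_comp_inner_gradient {E : Type*} [NormedAddCommGroup E]
    [InnerProductSpace ℝ E] [CompleteSpace E] {f : E → ℝ} {γ : ℝ → E} {v : E} {t : ℝ}
    (hf : DifferentiableAt ℝ f (γ t)) (hγ : HasDerivAt γ v t) :
    HasDerivAt (fun s => f (γ s)) ⟪gradient f (γ t), v⟫ t := by
  exact hf.hasGradientAt.hasFDerivAt.comp_hasDerivAt t hγ

/-- along any flowline starting on an admissible manifold `M`,
the sign of `f_M` equals the sign of the time parameter; in particular a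
flowline crosses `M` exactly once. -/
theorem statement10 {n : ℕ} (D : Set (Euc n)) (hD : IsOpen D) (hDne : D.Nonempty)
    (b : Euc n → Euc n) (hb : ContDiffOn ℝ 1 b D)
    (ψ : Euc n → ℝ → Euc n) (hψ : GeoIsFlow D b ψ)
    (M : Set (Euc n)) (f : Euc n → ℝ)
    (hM : GeoIsAdmissibleWith D b M f) :
    ∀ x ∈ M, ∀ t : ℝ,
      Real.sign (f (ψ x t)) = Real.sign t ∧ (ψ x t ∈ M ↔ t = 0) := by
  obtain ⟨hψ0, hψD, hψd⟩ := hψ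
  obtain ⟨hfc, hMeq, -, ⟨U, hU, hMU, -, hfU⟩, hpos⟩ := hM
  intro x hx t
  have hmem : ∀ y, y ∈ M ↔ y ∈ D ∧ f y = 0 := fun y => by rw [hMeq]; rfl
  obtain ⟨hxD, hfx⟩ := (hmem x).1 hx
  have hg : Continuous fun s => f (ψ x s) :=
    hfc.comp_continuous (continuous_iff_continuousAt.2 fun s => (hψd x hxD s).continuousAt)
      (hψD x hxD)
  have hd : ∀ s, f (ψ x s) = 0 → 0 < deriv (fun s => f (ψ x s)) s := by
    intro s hs
    have hm : ψ x s ∈ M := (hmem _).2 ⟨hψD x hxD s, hs⟩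
    have hdiff : DifferentiableAt ℝ f (ψ x s) :=
      (hfU.contDiffAt (hU.mem_nhds (hMU hm))).differentiableAt one_ne_zero
    rw [(hasDerivAt_comp_inner_gradient hdiff (hψd x hxD s)).deriv]
    exact hpos _ hm
  have h0 : f (ψ x 0) = 0 := by rw [hψ0 x hxD, hfx]
  rw [hmem, and_iff_right (hψD x hxD t)]
  rcases lt_trichotomy t 0 with ht | rfl | ht
  · have := neg_of_deriv_pos_at_zeros hg hd h0 ht
    rw [Real.sign_of_neg this, Real.sign_of_neg ht]
    exact ⟨rfl, iff_of_false this.ne ht.ne⟩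
  · simp [h0]
  · have := pos_of_deriv_pos_at_zeros hg hd h0 ht
    rw [Real.sign_of_pos this, Real.sign_of_pos ht]
    exact ⟨rfl, iff_of_false this.ne' ht.ne'⟩
end

section
/- Let D ⊆ ℝⁿ be open, let b : D → ℝⁿ be C¹ with globally defined flow ψ, and let M ⊆ D be an admissible manifold of b. Then the set ψ(M,ℝ) := {ψ(m,s) : m ∈ M, s ∈ ℝ} is open, and there exist C¹ functions z : ψ(M,ℝ) → ℝⁿ taking values in M and t : ψ(M,ℝ) → ℝ such that for every x ∈ ψ(M,ℝ) the pair (z(x), t(x)) is the unique pair (m,s) ∈ M × ℝ with ψ(m,s) = x. Moreover, for every x ∈ ψ(M,ℝ): the Fréchet derivative of z at x applied to b(x) is 0; ⟨∇t(x), b(x)⟩ = 1; and the three conditions x ∈ M, t(x) = 0, and z(x) = x are equivalent. -/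
open MeasureTheory Set Filter
open scoped RealInnerProductSpace

/-- `M` is an admissible manifold of `b`. -/
def GeoIsAdmissible {n : ℕ} (D : Set (Euc n)) (b : Euc n → Euc n)
    (M : Set (Euc n)) : Prop :=
  ∃ f : Euc n → ℝ, ContinuousOn f D ∧ M = {w ∈ D | f w = 0} ∧ IsCompact M ∧
    (∃ U : Set (Euc n), IsOpen U ∧ M ⊆ U ∧ U ⊆ D ∧ ContDiffOn ℝ 1 f U) ∧
    ∀ x ∈ M, 0 < ⟪gradient f x, b x⟫

open scoped Topology

section Nemytskii

variable {K E F : Type*} [TopologicalSpace K] [CompactSpace K] [NormedAddCommGroup E]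
  [NormedSpace ℝ E] [NormedAddCommGroup F] [NormedSpace ℝ F]

/-- Pointwise application of a continuous family of operators to a continuous function, as a
bounded bilinear map. -/
noncomputable def pointwiseApplyCLM : C(K, E →L[ℝ] F) →L[ℝ] C(K, E) →L[ℝ] C(K, F) :=
  LinearMap.mkContinuous₂
    (LinearMap.mk₂ ℝ (fun (A : C(K, E →L[ℝ] F)) (h : C(K, E)) =>
        (⟨fun s => A s (h s), by fun_prop⟩ : C(K, F)))
      (fun _ _ _ => by ext; simp) (fun _ _ _ => by ext; simp)
      (fun _ _ _ => by ext; simp) (fun _ _ _ => by ext; simp))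
    1 fun A h => by
      rw [ContinuousMap.norm_le _ (by positivity)]
      intro s
      calc ‖A s (h s)‖ ≤ ‖A s‖ * ‖h s‖ := (A s).le_opNorm _
        _ ≤ 1 * ‖A‖ * ‖h‖ := by
          rw [one_mul]
          gcongr
          exacts [A.norm_coe_le_norm s, h.norm_coe_le_norm s]

/-- The superposition operator `α ↦ g ∘ α` on continuous functions on a compact space is `C¹` as
soon as `g` is `C¹` with uniformly continuous derivative. -/
theorem contDiff_one_postcomp {g : E → F} (hg : ContDiff ℝ 1 g)
    (hu : UniformContinuous (fderiv ℝ g)) :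
    ContDiff ℝ 1 (fun α : C(K, E) => (⟨g, hg.continuous⟩ : C(E, F)).comp α) := by
  have hdg : Continuous (fderiv ℝ g) := hg.continuous_fderiv one_ne_zero
  rw [contDiff_one_iff_hasFDerivAt]
  refine ⟨fun α => pointwiseApplyCLM ((⟨fderiv ℝ g, hdg⟩ : C(E, E →L[ℝ] F)).comp α),
    pointwiseApplyCLM.continuous.comp (ContinuousMap.continuous_postcomp _), fun α => ?_⟩
  rw [hasFDerivAt_iff_isLittleO_nhds_zero, Asymptotics.isLittleO_iff]
  intro c hc
  obtain ⟨δ, hδ, hδc⟩ := Metric.uniformContinuous_iff.1 hu c hc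
  filter_upwards [Metric.ball_mem_nhds 0 hδ] with h hh
  rw [mem_ball_zero_iff] at hh
  rw [ContinuousMap.norm_le _ (by positivity)]
  intro s
  have key : ‖g (α s + h s) - g (α s) - fderiv ℝ g (α s) (α s + h s - α s)‖ ≤
      c * ‖α s + h s - α s‖ := by
    refine (convex_ball (α s) δ).norm_image_sub_le_of_norm_fderiv_le'
      (fun x _ => hg.differentiable one_ne_zero x) (fun x hx => ?_)
      (Metric.mem_ball_self hδ) ?_
    · rw [← dist_eq_norm]
      exact (hδc hx).le
    · simpa using (h.norm_coe_le_norm s).trans_lt hh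
  simp only [add_sub_cancel_left] at key
  refine le_trans (le_of_eq ?_) (key.trans ?_)
  · rfl
  · gcongr
    exact h.norm_coe_le_norm s

end Nemytskii

/-- Two solutions in an open set `D` of an autonomous equation with `C¹` right-hand side, defined on
a common open interval and agreeing at one time, agree. -/
theorem eqOn_of_hasDerivAt_of_contDiffOn {E : Type*} [NormedAddCommGroup E] [NormedSpace ℝ E]
    {D : Set E} (hD : IsOpen D) {b : E → E} (hb : ContDiffOn ℝ 1 b D) {J : Set ℝ}
    (hJo : IsOpen J) (hJ : IsPreconnected J) {γ₁ γ₂ : ℝ → E}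
    (h₁ : ∀ t ∈ J, HasDerivAt γ₁ (b (γ₁ t)) t ∧ γ₁ t ∈ D)
    (h₂ : ∀ t ∈ J, HasDerivAt γ₂ (b (γ₂ t)) t ∧ γ₂ t ∈ D)
    {t₀ : ℝ} (ht₀ : t₀ ∈ J) (heq : γ₁ t₀ = γ₂ t₀) : EqOn γ₁ γ₂ J := by
  have main : ∀ t ∈ J, γ₁ t = γ₂ t → γ₁ =ᶠ[𝓝 t] γ₂ := by
    intro t ht hte
    obtain ⟨K, s, hs, hlip⟩ :=
      (hb.contDiffAt (hD.mem_nhds (h₁ t ht).2)).exists_lipschitzOnWith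
    have hJt := hJo.mem_nhds ht
    refine ODE_solution_unique_of_eventually (v := fun _ => b) (s := fun _ => s) (K := K)
      (Eventually.of_forall fun _ => hlip) ?_ ?_ hte
    · filter_upwards [hJt, (h₁ t ht).1.continuousAt hs] with r hr hr'
      exact ⟨(h₁ r hr).1, hr'⟩
    · filter_upwards [hJt, (h₂ t ht).1.continuousAt (hte ▸ hs)] with r hr hr'
      exact ⟨(h₂ r hr).1, hr'⟩
  have hsub : J ⊆ {t | γ₁ =ᶠ[𝓝 t] γ₂} := by
    refine hJ.subset_of_closure_inter_subset isOpen_setOfPred_eventually_nhds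
      ⟨t₀, ht₀, main t₀ ht₀ heq⟩ ?_
    rintro t ⟨htc, ht⟩
    refine main t ht ?_
    have hfr : ∃ᶠ s in 𝓝 t, γ₁ s - γ₂ s = 0 :=
      (mem_closure_iff_frequently.1 htc).mono fun s hs => sub_eq_zero.2 hs.self_of_nhds
    have hc : ContinuousAt (fun s => γ₁ s - γ₂ s) t :=
      (h₁ t ht).1.continuousAt.sub (h₂ t ht).1.continuousAt
    by_contra hne
    exact hfr (hc.eventually_ne (sub_ne_zero.2 hne))
  exact fun t ht => (hsub ht).self_of_nhds

/-- Integration from `0` on `[-2, 2]`, as a bounded operator on continuous functions. -/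
noncomputable def integralFromZeroCLM (E : Type*) [NormedAddCommGroup E] [NormedSpace ℝ E] :
    C(Icc (-2 : ℝ) 2, E) →L[ℝ] C(Icc (-2 : ℝ) 2, E) :=
  LinearMap.mkContinuous
    { toFun := fun α => ⟨fun s => ∫ r in (0 : ℝ)..s, IccExtend (by norm_num) α r, by
        have : Continuous fun s : ℝ => ∫ r in (0 : ℝ)..s, IccExtend (by norm_num) α r :=
          intervalIntegral.continuous_primitive
            (fun a b => α.continuous.Icc_extend'.intervalIntegrable a b) 0
        exact this.comp continuous_subtype_val⟩
      map_add' := fun α β => by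
        ext s
        exact intervalIntegral.integral_add (α.continuous.Icc_extend'.intervalIntegrable _ _)
          (β.continuous.Icc_extend'.intervalIntegrable _ _)
      map_smul' := fun c α => by
        ext s
        exact intervalIntegral.integral_smul c _ }
    2 fun α => by
      rw [ContinuousMap.norm_le _ (by positivity)]
      intro s
      have h := intervalIntegral.norm_integral_le_of_norm_le_const (a := 0) (b := (s : ℝ))
        (C := ‖α‖) (f := IccExtend (by norm_num) α) fun r _ => α.norm_coe_le_norm _
      refine h.trans ?_
      rw [mul_comm, sub_zero]
      gcongr
      exact abs_le.2 s.2

/-- The integral equation `α s = x + T • ∫ r in 0..s, g (α r)` on `[-2, 2]` has a solution which is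
a `C¹` function of the initial value `x` and the time scale `T`, near `T = 0`. -/
theorem exists_contDiffAt_solution_integral_equation {E : Type*} [NormedAddCommGroup E]
    [NormedSpace ℝ E] [CompleteSpace E] {g : E → E} (hg : ContDiff ℝ 1 g)
    (hu : UniformContinuous (fderiv ℝ g)) (x₀ : E) :
    ∃ θ : E × ℝ → C(Icc (-2 : ℝ) 2, E), ContDiffAt ℝ 1 θ (x₀, 0) ∧
      θ (x₀, 0) = ContinuousMap.const _ x₀ ∧
      ∀ᶠ p in 𝓝 (x₀, (0 : ℝ)), ∀ s : Icc (-2 : ℝ) 2,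
        θ p s = p.1 + p.2 • ∫ r in (0 : ℝ)..s, g (IccExtend (by norm_num) (θ p) r) := by
  set N : C(Icc (-2 : ℝ) 2, E) → C(Icc (-2 : ℝ) 2, E) :=
    fun α => (⟨g, hg.continuous⟩ : C(E, E)).comp α
  have hNc : ContDiff ℝ 1 N := contDiff_one_postcomp hg hu
  set c : E →L[ℝ] C(Icc (-2 : ℝ) 2, E) := ContinuousLinearMap.const ℝ _
  set G : (E × ℝ) × C(Icc (-2 : ℝ) 2, E) → C(Icc (-2 : ℝ) 2, E) :=
    fun q => q.2 - c q.1.1 - q.1.2 • integralFromZeroCLM E (N q.2) with hG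
  set u : (E × ℝ) × C(Icc (-2 : ℝ) 2, E) := ((x₀, 0), c x₀) with hu'
  have hGc : ContDiff ℝ 1 G := by
    refine (contDiff_snd.sub (c.contDiff.comp contDiff_fst.fst)).sub (contDiff_fst.snd.smul ?_)
    exact (integralFromZeroCLM E).contDiff.comp (hNc.comp contDiff_snd)
  have hpart : fderiv ℝ G u ∘L .inr ℝ (E × ℝ) C(Icc (-2 : ℝ) 2, E) = .id ℝ _ := by
    have h1 : HasFDerivAt (fun α : C(Icc (-2 : ℝ) 2, E) => G ((x₀, 0), α))
        (fderiv ℝ G u ∘L .inr ℝ (E × ℝ) C(Icc (-2 : ℝ) 2, E)) (c x₀) :=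
      (hGc.differentiable one_ne_zero u).hasFDerivAt.comp (c x₀) (hasFDerivAt_prodMk_right _ _)
    have h2 : HasFDerivAt (fun α : C(Icc (-2 : ℝ) 2, E) => G ((x₀, 0), α))
        (.id ℝ C(Icc (-2 : ℝ) 2, E)) (c x₀) := by
      simpa [hG] using (hasFDerivAt_id (𝕜 := ℝ) (c x₀)).sub_const (c x₀)
    exact h1.unique h2
  have hinv : (fderiv ℝ G u ∘L .inr ℝ (E × ℝ) C(Icc (-2 : ℝ) 2, E)).IsInvertible := by
    rw [hpart]
    exact ⟨.refl ℝ _, rfl⟩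
  have hGu : G u = 0 := by simp [hG, hu']
  have hGa : ContDiffAt ℝ 1 G u := hGc.contDiffAt
  refine ⟨hGa.implicitFunction one_ne_zero hinv,
    hGa.contDiffAt_implicitFunction one_ne_zero hinv,
    hGa.implicitFunction_apply_self one_ne_zero hinv, ?_⟩
  filter_upwards [hGa.eventually_apply_implicitFunction one_ne_zero hinv] with p hp s
  rw [hGu] at hp
  exact DFunLike.congr_fun (sub_eq_zero.1 ((sub_sub _ _ _).symm.trans hp)) s

/-- A vector field which is `C¹` on an open set agrees near each point of it with a globally defined
compactly supported `C¹` vector field. -/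
theorem ContDiffOn.exists_contDiff_hasCompactSupport_eventuallyEq {E F : Type*}
    [NormedAddCommGroup E] [NormedSpace ℝ E] [FiniteDimensional ℝ E]
    [NormedAddCommGroup F] [NormedSpace ℝ F] {D : Set E} (hD : IsOpen D) {b : E → F}
    (hb : ContDiffOn ℝ 1 b D) {x₀ : E} (hx₀ : x₀ ∈ D) :
    ∃ g : E → F, ContDiff ℝ 1 g ∧ HasCompactSupport g ∧ g =ᶠ[𝓝 x₀] b := by
  obtain ⟨r, hr, hrD⟩ := Metric.nhds_basis_closedBall.mem_iff.1 (hD.mem_nhds hx₀)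
  let f : ContDiffBump x₀ := ⟨r / 2, r, half_pos hr, half_lt_self hr⟩
  refine ⟨fun x => f x • b x, ?_, f.hasCompactSupport.smul_right, ?_⟩
  · refine contDiff_iff_contDiffAt.2 fun x => ?_
    by_cases hx : x ∈ tsupport f
    · exact f.contDiffAt.smul (hb.contDiffAt (hD.mem_nhds (hrD (f.tsupport_eq ▸ hx))))
    · refine (contDiffAt_const (c := (0 : F))).congr_of_eventuallyEq ?_
      filter_upwards [notMem_tsupport_iff_eventuallyEq.1 hx] with y hy
      simp [hy]
  · filter_upwards [f.eventuallyEq_one] with x hx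
    simp [hx]

/-- The flow of a `C¹` vector field is `C¹` near time zero. -/
theorem contDiffAt_flow_zero {E : Type*} [NormedAddCommGroup E] [NormedSpace ℝ E]
    [FiniteDimensional ℝ E] {D : Set E} (hD : IsOpen D) {b : E → E} (hb : ContDiffOn ℝ 1 b D)
    {ψ : E → ℝ → E} (h_zero : ∀ x ∈ D, ψ x 0 = x) (h_mem : ∀ x ∈ D, ∀ t, ψ x t ∈ D)
    (h_deriv : ∀ x ∈ D, ∀ t, HasDerivAt (ψ x) (b (ψ x t)) t) {x₀ : E} (hx₀ : x₀ ∈ D) :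
    ContDiffAt ℝ 1 (fun p : E × ℝ => ψ p.1 p.2) (x₀, 0) := by
  obtain ⟨g, hg, hgc, hgb⟩ := hb.exists_contDiff_hasCompactSupport_eventuallyEq hD hx₀
  have hgu : UniformContinuous (fderiv ℝ g) :=
    (hgc.fderiv (𝕜 := ℝ)).uniformContinuous_of_continuous (hg.continuous_fderiv one_ne_zero)
  obtain ⟨θ, hθ, hθ₀, hθi⟩ := exists_contDiffAt_solution_integral_equation hg hgu x₀
  obtain ⟨r, hr, hrb⟩ := Metric.eventually_nhds_iff_ball.1 (hgb.and (hD.mem_nhds hx₀))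
  have hclose : ∀ᶠ p in 𝓝 (x₀, (0 : ℝ)), θ p ∈ Metric.ball (ContinuousMap.const _ x₀) r :=
    hθ.continuousAt (hθ₀ ▸ Metric.ball_mem_nhds _ hr)
  have hpD : ∀ᶠ p : E × ℝ in 𝓝 (x₀, (0 : ℝ)), p.1 ∈ D :=
    continuousAt_fst (hD.mem_nhds hx₀)
  have h1 : (1 : ℝ) ∈ Icc (-2 : ℝ) 2 := by constructor <;> norm_num
  have heq : (fun p : E × ℝ => ψ p.1 p.2) =ᶠ[𝓝 (x₀, 0)] fun p => θ p ⟨1, h1⟩ := by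
    filter_upwards [hclose, hpD, hθi] with p hp hpD hpi
    have hball (s : Icc (-2 : ℝ) 2) : θ p s ∈ Metric.ball x₀ r :=
      (ContinuousMap.dist_apply_le_dist (f := θ p) (g := .const _ x₀) s).trans_lt hp
    set γ : ℝ → E := fun s => p.1 + p.2 • ∫ r in (0 : ℝ)..s, g (IccExtend (by norm_num) (θ p) r)
    have hγ (s : ℝ) (hs : s ∈ Icc (-2 : ℝ) 2) : γ s = θ p ⟨s, hs⟩ := (hpi ⟨s, hs⟩).symm
    have hcont : Continuous fun r => g (IccExtend (by norm_num) (θ p) r) :=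
      hg.continuous.comp (θ p).continuous.Icc_extend'
    have hψ (s : ℝ) : HasDerivAt (fun s => ψ p.1 (p.2 * s)) (p.2 • b (ψ p.1 (p.2 * s))) s := by
      simpa [Function.comp_def] using
        (h_deriv p.1 hpD (p.2 * s)).scomp s ((hasDerivAt_id s).const_mul p.2)
    have := eqOn_of_hasDerivAt_of_contDiffOn hD (b := fun y => p.2 • b y) (hb.const_smul p.2)
      (J := Ioo (-2) 2) isOpen_Ioo isPreconnected_Ioo (γ₁ := fun s => ψ p.1 (p.2 * s)) (γ₂ := γ)
      (fun s _ => ⟨hψ s, h_mem _ hpD _⟩)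
      (fun s hs => by
        have hs' := Ioo_subset_Icc_self hs
        have hb' := hrb _ (hball ⟨s, hs'⟩)
        refine ⟨?_, by rw [hγ s hs']; exact hb'.2⟩
        have hd := ((hcont.integral_hasStrictDerivAt 0 s).hasDerivAt.const_smul p.2).const_add p.1
        rw [IccExtend_of_mem _ _ hs', hb'.1, ← hγ s hs'] at hd
        exact hd)
      (t₀ := 0) (by constructor <;> norm_num) (by simp [γ, h_zero _ hpD])
      (show (1 : ℝ) ∈ Ioo (-2 : ℝ) 2 by constructor <;> norm_num)
    simpa [hγ 1 h1] using this
  refine ContDiffAt.congr_of_eventuallyEq ?_ heq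
  exact (ContinuousMap.evalCLM ℝ (⟨1, h1⟩ : Icc (-2 : ℝ) 2)).contDiff.contDiffAt.comp _ hθ

/-- A flow of a `C¹` vector field is a group action. -/
theorem flow_add {E : Type*} [NormedAddCommGroup E] [NormedSpace ℝ E]
    {D : Set E} (hD : IsOpen D) {b : E → E} (hb : ContDiffOn ℝ 1 b D)
    {ψ : E → ℝ → E} (h_zero : ∀ x ∈ D, ψ x 0 = x) (h_mem : ∀ x ∈ D, ∀ t, ψ x t ∈ D)
    (h_deriv : ∀ x ∈ D, ∀ t, HasDerivAt (ψ x) (b (ψ x t)) t) {x : E} (hx : x ∈ D) (s t : ℝ) :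
    ψ x (s + t) = ψ (ψ x s) t :=
  eqOn_of_hasDerivAt_of_contDiffOn hD hb isOpen_univ isPreconnected_univ
    (γ₁ := fun t => ψ x (s + t)) (γ₂ := ψ (ψ x s))
    (fun t _ => ⟨(h_deriv x hx (s + t)).comp_const_add s t, h_mem x hx _⟩)
    (fun t _ => ⟨h_deriv _ (h_mem x hx s) t, h_mem _ (h_mem x hx s) t⟩)
    (mem_univ 0) (by simp [h_zero _ (h_mem x hx s)]) (mem_univ t)

/-- The flow of a `C¹` vector field is jointly `C¹`. -/
theorem contDiffAt_flow {E : Type*} [NormedAddCommGroup E] [NormedSpace ℝ E]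
    [FiniteDimensional ℝ E] {D : Set E} (hD : IsOpen D) {b : E → E} (hb : ContDiffOn ℝ 1 b D)
    {ψ : E → ℝ → E} (h_zero : ∀ x ∈ D, ψ x 0 = x) (h_mem : ∀ x ∈ D, ∀ t, ψ x t ∈ D)
    (h_deriv : ∀ x ∈ D, ∀ t, HasDerivAt (ψ x) (b (ψ x t)) t) {x₀ : E} (hx₀ : x₀ ∈ D) (t₀ : ℝ) :
    ContDiffAt ℝ 1 (fun p : E × ℝ => ψ p.1 p.2) (x₀, t₀) := by
  have hadd {x : E} (hx : x ∈ D) (s t : ℝ) : ψ x (s + t) = ψ (ψ x s) t :=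
    flow_add hD hb h_zero h_mem h_deriv hx s t
  have hloc {x : E} (hx : x ∈ D) :
      ∀ᶠ p in 𝓝 (x, (0 : ℝ)), ContDiffAt ℝ 1 (fun p : E × ℝ => ψ p.1 p.2) p :=
    (contDiffAt_flow_zero hD hb h_zero h_mem h_deriv hx).eventually (by simp)
  have hnear : ∀ᶠ x in 𝓝 x₀, x ∈ D := hD.mem_nhds hx₀
  have hstep {s t : ℝ} (hs : ContDiffAt ℝ 1 (fun x => ψ x s) x₀)
      (ht : ContDiffAt ℝ 1 (fun p : E × ℝ => ψ p.1 p.2) (ψ x₀ s, t - s)) :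
      ContDiffAt ℝ 1 (fun p : E × ℝ => ψ p.1 p.2) (x₀, t) := by
    have hcomp : ContDiffAt ℝ 1 (fun p : E × ℝ => ψ (ψ p.1 s) (p.2 - s)) (x₀, t) := by
      have hin : ContDiffAt ℝ 1 (fun p : E × ℝ => (ψ p.1 s, p.2 - s)) (x₀, t) :=
        (ContDiffAt.comp (x₀, t) (g := fun x => ψ x s) hs contDiffAt_fst).prodMk
          (contDiffAt_snd.sub contDiffAt_const)
      exact ContDiffAt.comp (x₀, t) (g := fun p : E × ℝ => ψ p.1 p.2) ht hin
    refine hcomp.congr_of_eventuallyEq ?_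
    filter_upwards [continuousAt_fst (hD.mem_nhds hx₀)] with p hp
    rw [← hadd hp, add_sub_cancel]
  have hslice {t : ℝ} (ht : ContDiffAt ℝ 1 (fun p : E × ℝ => ψ p.1 p.2) (x₀, t)) :
      ContDiffAt ℝ 1 (fun x => ψ x t) x₀ :=
    ContDiffAt.comp x₀ (g := fun p : E × ℝ => ψ p.1 p.2) (f := fun x => (x, t)) ht
      (contDiffAt_id.prodMk contDiffAt_const)
  have hnhds (t : ℝ) : ∀ᶠ s in 𝓝 t,
      ContDiffAt ℝ 1 (fun p : E × ℝ => ψ p.1 p.2) (ψ x₀ s, t - s) := by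
    have hc : ContinuousAt (fun s => (ψ x₀ s, t - s)) t :=
      (h_deriv x₀ hx₀ t).continuousAt.prodMk (by fun_prop)
    exact hc.eventually (by simpa using hloc (h_mem x₀ hx₀ t))
  set S : Set ℝ := {t | ContDiffAt ℝ 1 (fun p : E × ℝ => ψ p.1 p.2) (x₀, t)}
  have hSo : IsOpen S := by
    rw [isOpen_iff_mem_nhds]
    intro t ht
    exact (Continuous.prodMk_right x₀).continuousAt.eventually
      (ContDiffAt.eventually ht (by simp))
  have hS : univ ⊆ S := by
    refine isPreconnected_univ.subset_of_closure_inter_subset hSo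
      ⟨0, mem_univ _, contDiffAt_flow_zero hD hb h_zero h_mem h_deriv hx₀⟩ ?_
    rintro t ⟨ht, -⟩
    obtain ⟨s, hs, hst⟩ := ((mem_closure_iff_frequently.1 ht).and_eventually (hnhds t)).exists
    exact hstep (hslice hs) hst
  exact hS (mem_univ t₀)

/-- A continuous function which crosses zero only upwards has at most one zero. -/
theorem eq_of_eq_zero_of_deriv_pos {g : ℝ → ℝ} (hg : Continuous g)
    (hg' : ∀ t, g t = 0 → 0 < deriv g t) {s t : ℝ} (hs : g s = 0) (ht : g t = 0) : s = t := by
  wlog hst : s ≤ t generalizing s t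
  · exact (this ht hs (le_of_not_ge hst)).symm
  by_contra hne
  have hlt : s < t := lt_of_le_of_ne hst hne
  obtain ⟨a, hga, hsa, hat⟩ : ∃ a, SignType.sign (g a) = SignType.sign (a - s) ∧ s < a ∧ a < t :=
    (((eventually_nhdsWithin_sign_eq_of_deriv_pos (hg' s hs) hs).filter_mono
      nhdsWithin_le_nhds).and (Ioo_mem_nhdsGT hlt)).exists
  rw [sign_pos (sub_pos.2 hsa), sign_eq_one_iff] at hga
  obtain ⟨c, ⟨⟨hac, hct⟩, hgc⟩, hmin⟩ : ∃ c, IsLeast (Icc a t ∩ g ⁻¹' {0}) c :=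
    (isCompact_Icc.inter_right (isClosed_singleton.preimage hg)).exists_isLeast
      ⟨t, ⟨hat.le, le_rfl⟩, ht⟩
  have hgc : g c = 0 := hgc
  have hac' : a < c := lt_of_le_of_ne hac fun h => hga.ne' (h ▸ hgc)
  obtain ⟨d, hgd, had, hdc⟩ : ∃ d, SignType.sign (g d) = SignType.sign (d - c) ∧ a < d ∧ d < c :=
    (((eventually_nhdsWithin_sign_eq_of_deriv_pos (hg' c hgc) hgc).filter_mono
      nhdsWithin_le_nhds).and (Ioo_mem_nhdsLT hac')).exists
  rw [sign_neg (sub_neg.2 hdc), sign_eq_neg_one_iff] at hgd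
  obtain ⟨e, he, hge⟩ := intermediate_value_Icc' had.le hg.continuousOn ⟨hgd.le, hga.le⟩
  exact absurd (hmin ⟨⟨he.1, (he.2.trans hdc.le).trans hct⟩, hge⟩) (not_le.2 (he.2.trans_lt hdc))

/-- If `F` is `C¹` at `(x₀, t₀)`, vanishes there, and has nonzero derivative in the real variable,
then its zero set near `x₀` contains the graph of a `C¹` function. -/
theorem exists_contDiffAt_eventually_eq_zero {E : Type*} [NormedAddCommGroup E] [NormedSpace ℝ E]
    [CompleteSpace E] {F : E × ℝ → ℝ} {x₀ : E} {t₀ c : ℝ} (hF : ContDiffAt ℝ 1 F (x₀, t₀))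
    (hF₀ : F (x₀, t₀) = 0) (hc : HasDerivAt (fun t => F (x₀, t)) c t₀) (hc₀ : c ≠ 0) :
    ∃ θ : E → ℝ, ContDiffAt ℝ 1 θ x₀ ∧ ∀ᶠ x in 𝓝 x₀, F (x, θ x) = 0 := by
  have hpart : HasFDerivAt (fun t => F (x₀, t)) (fderiv ℝ F (x₀, t₀) ∘L .inr ℝ E ℝ) t₀ :=
    (hF.differentiableAt one_ne_zero).hasFDerivAt.comp t₀ (hasFDerivAt_prodMk_right _ _)
  have hinv : (fderiv ℝ F (x₀, t₀) ∘L .inr ℝ E ℝ).IsInvertible := by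
    rw [hpart.unique hc.hasFDerivAt]
    refine ⟨ContinuousLinearEquiv.unitsEquivAut ℝ (Units.mk0 c hc₀), ?_⟩
    ext
    simp
  exact ⟨hF.implicitFunction one_ne_zero hinv, hF.contDiffAt_implicitFunction one_ne_zero hinv,
    hF₀ ▸ hF.eventually_apply_implicitFunction one_ne_zero hinv⟩

/-- the tube `ψ(M,ℝ)` of an admissible manifold `M` is open and
carries unique `C¹` coordinate functions `z` (base point on `M`) and `τ`
(travel time), with `∇z·b = 0`, `⟨∇τ,b⟩ = 1`, and
`x ∈ M ↔ τ(x) = 0 ↔ z(x) = x`. -/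
theorem statement12 {n : ℕ} (D : Set (Euc n)) (hD : IsOpen D) (hDne : D.Nonempty)
    (b : Euc n → Euc n) (hb : ContDiffOn ℝ 1 b D)
    (ψ : Euc n → ℝ → Euc n) (hψ : GeoIsFlow D b ψ)
    (M : Set (Euc n)) (hM : GeoIsAdmissible D b M) :
    IsOpen {w : Euc n | ∃ m ∈ M, ∃ s : ℝ, ψ m s = w} ∧
    ∃ z : Euc n → Euc n, ∃ τ : Euc n → ℝ,
      ContDiffOn ℝ 1 z {w : Euc n | ∃ m ∈ M, ∃ s : ℝ, ψ m s = w} ∧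
      ContDiffOn ℝ 1 τ {w : Euc n | ∃ m ∈ M, ∃ s : ℝ, ψ m s = w} ∧
      ∀ x ∈ {w : Euc n | ∃ m ∈ M, ∃ s : ℝ, ψ m s = w},
        z x ∈ M ∧ ψ (z x) (τ x) = x ∧
        (∀ m : Euc n, ∀ s : ℝ, m ∈ M → ψ m s = x → m = z x ∧ s = τ x) ∧
        fderiv ℝ z x (b x) = 0 ∧
        ⟪gradient τ x, b x⟫ = 1 ∧
        (x ∈ M ↔ τ x = 0) ∧ (x ∈ M ↔ z x = x) := by
  obtain ⟨h_zero, h_mem, h_deriv⟩ := hψ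
  obtain ⟨f, hfc, hMf, -, ⟨U, hUo, hMU, -, hfU⟩, hgrad⟩ := hM
  have hMD {m : Euc n} (hm : m ∈ M) : m ∈ D := (hMf ▸ hm : m ∈ {w ∈ D | f w = 0}).1
  have hM_iff {w : Euc n} (hw : w ∈ D) : w ∈ M ↔ f w = 0 := by
    rw [hMf]
    exact and_iff_right hw
  have hadd {x : Euc n} (hx : x ∈ D) (s t : ℝ) : ψ x (s + t) = ψ (ψ x s) t :=
    flow_add hD hb h_zero h_mem h_deriv hx s t
  have hfM {m : Euc n} (hm : m ∈ M) : ContDiffAt ℝ 1 f m :=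
    hfU.contDiffAt (hUo.mem_nhds (hMU hm))
  -- along an orbit, `f` has positive derivative at each point of `M`
  have hcross {x : Euc n} (hx : x ∈ D) {t : ℝ} (ht : ψ x t ∈ M) :
      ∃ c, 0 < c ∧ HasDerivAt (fun t => f (ψ x t)) c t :=
    ⟨_, inner_gradient_left (𝕜 := ℝ) (f := f) ▸ hgrad _ ht,
      ((hfM ht).differentiableAt one_ne_zero).hasFDerivAt.comp_hasDerivAt t (h_deriv x hx t)⟩
  have htime {x : Euc n} (hx : x ∈ D) {s t : ℝ} (hs : ψ x s ∈ M) (ht : ψ x t ∈ M) : s = t := by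
    refine eq_of_eq_zero_of_deriv_pos (g := fun t => f (ψ x t)) ?_ ?_
      ((hM_iff (h_mem x hx s)).1 hs) ((hM_iff (h_mem x hx t)).1 ht)
    · exact hfc.comp_continuous
        (continuous_iff_continuousAt.2 fun t => (h_deriv x hx t).continuousAt) (h_mem x hx)
    · intro r hr
      obtain ⟨c, hc, hcd⟩ := hcross hx ((hM_iff (h_mem x hx r)).2 hr)
      rwa [hcd.deriv]
  have huniq {m m' : Euc n} {s s' : ℝ} (hm : m ∈ M) (hm' : m' ∈ M) (h : ψ m s = ψ m' s') :
      m = m' ∧ s = s' := by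
    have h1 : ψ m (s - s') = m' := by
      rw [sub_eq_add_neg, hadd (hMD hm), h, ← hadd (hMD hm'), add_neg_cancel, h_zero _ (hMD hm')]
    have h2 : s - s' = 0 :=
      htime (hMD hm) (h1.symm ▸ hm') ((h_zero m (hMD hm)).symm ▸ hm)
    exact ⟨by rw [← h1, h2, h_zero _ (hMD hm)], sub_eq_zero.1 h2⟩
  set W : Set (Euc n) := {w : Euc n | ∃ m ∈ M, ∃ s : ℝ, ψ m s = w}
  choose! z hzM τ hzτ using fun x (hx : x ∈ W) => hx
  have hzτ_eq {x m : Euc n} {s : ℝ} (hm : m ∈ M) (h : ψ m s = x) : m = z x ∧ s = τ x :=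
    have hx : x ∈ W := ⟨m, hm, s, h⟩
    huniq hm (hzM x hx) (h.trans (hzτ x hx).symm)
  have hWD {x : Euc n} (hx : x ∈ W) : x ∈ D := hzτ x hx ▸ h_mem _ (hMD (hzM x hx)) _
  have hback {x : Euc n} (hx : x ∈ D) {t : ℝ} (ht : ψ x t ∈ M) :
      x ∈ W ∧ z x = ψ x t ∧ τ x = -t := by
    have h : ψ (ψ x t) (-t) = x := by rw [← hadd hx, add_neg_cancel, h_zero _ hx]
    exact ⟨⟨_, ht, _, h⟩, (hzτ_eq ht h).1.symm, (hzτ_eq ht h).2.symm⟩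
  have hreturn {x : Euc n} (hx : x ∈ W) : ψ x (-τ x) = z x := by
    nth_rw 1 [← hzτ x hx]
    rw [← hadd (hMD (hzM x hx)), add_neg_cancel, h_zero _ (hMD (hzM x hx))]
  have hflow {x : Euc n} (hx : x ∈ W) (t : ℝ) : z (ψ x t) = z x ∧ τ (ψ x t) = τ x + t := by
    have h : ψ (z x) (τ x + t) = ψ x t := by rw [hadd (hMD (hzM x hx)), hzτ x hx]
    exact ⟨(hzτ_eq (hzM x hx) h).1.symm, (hzτ_eq (hzM x hx) h).2.symm⟩
  have hlocal {x : Euc n} (hx : x ∈ W) :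
      ∃ θ : Euc n → ℝ, ContDiffAt ℝ 1 θ x ∧ ∀ᶠ y in 𝓝 x, y ∈ D ∧ ψ y (θ y) ∈ M := by
    have hret : ψ x (-τ x) ∈ M := (hreturn hx).symm ▸ hzM x hx
    obtain ⟨c, hc, hcd⟩ := hcross (hWD hx) hret
    obtain ⟨θ, hθ, hθM⟩ :=
      exists_contDiffAt_eventually_eq_zero (F := fun p : Euc n × ℝ => f (ψ p.1 p.2))
        (ContDiffAt.comp (x, -τ x) (g := f) (f := fun p : Euc n × ℝ => ψ p.1 p.2) (hfM hret)
          (contDiffAt_flow hD hb h_zero h_mem h_deriv (hWD hx) (-τ x)))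
        ((hM_iff (h_mem _ (hWD hx) _)).1 hret) hcd hc.ne'
    refine ⟨θ, hθ, ?_⟩
    filter_upwards [hθM, hD.mem_nhds (hWD hx)] with y hy hyD
    exact ⟨hyD, (hM_iff (h_mem _ hyD _)).2 hy⟩
  have hτc {x : Euc n} (hx : x ∈ W) : ContDiffAt ℝ 1 τ x := by
    obtain ⟨θ, hθ, hθM⟩ := hlocal hx
    exact hθ.neg.congr_of_eventuallyEq (hθM.mono fun y hy => (hback hy.1 hy.2).2.2)
  have hzc {x : Euc n} (hx : x ∈ W) : ContDiffAt ℝ 1 z x := by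
    obtain ⟨θ, hθ, hθM⟩ := hlocal hx
    refine ContDiffAt.congr_of_eventuallyEq ?_ (hθM.mono fun y hy => (hback hy.1 hy.2).2.1)
    exact ContDiffAt.comp x (g := fun p : Euc n × ℝ => ψ p.1 p.2) (f := fun y => (y, θ y))
      (contDiffAt_flow hD hb h_zero h_mem h_deriv (hWD hx) (θ x)) (contDiffAt_id.prodMk hθ)
  have hderiv {x : Euc n} (hx : x ∈ W) : HasDerivAt (ψ x) (b x) 0 := by
    simpa [h_zero x (hWD hx)] using h_deriv x (hWD hx) 0
  refine ⟨isOpen_iff_mem_nhds.2 fun x hx => ?_, z, τ, fun x hx => (hzc hx).contDiffWithinAt,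
    fun x hx => (hτc hx).contDiffWithinAt, fun x hx => ⟨hzM x hx, hzτ x hx,
      fun m s hm h => hzτ_eq hm h, ?_, ?_, ?_, ?_⟩⟩
  · obtain ⟨θ, -, hθM⟩ := hlocal hx
    exact hθM.mono fun y hy => (hback hy.1 hy.2).1
  · have h := HasFDerivAt.comp_hasDerivAt_of_eq 0
      ((hzc hx).differentiableAt one_ne_zero).hasFDerivAt (hderiv hx) (h_zero x (hWD hx)).symm
    have hconst : z ∘ ψ x = fun _ => z x := funext fun t => (hflow hx t).1
    rw [hconst] at h
    exact h.unique (hasDerivAt_const _ _)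
  · rw [inner_gradient_left]
    have h := HasFDerivAt.comp_hasDerivAt_of_eq 0
      ((hτc hx).differentiableAt one_ne_zero).hasFDerivAt (hderiv hx) (h_zero x (hWD hx)).symm
    have haffine : τ ∘ ψ x = fun t => τ x + t := funext fun t => (hflow hx t).2
    rw [haffine] at h
    exact h.unique ((hasDerivAt_id 0).const_add _)
  · refine ⟨fun h => ((hzτ_eq h (h_zero x (hWD hx))).2).symm, fun h => ?_⟩
    rw [← hzτ x hx, h, h_zero _ (hMD (hzM x hx))]
    exact hzM x hx
  · exact ⟨fun h => ((hzτ_eq h (h_zero x (hWD hx))).1).symm, fun h => h ▸ hzM x hx⟩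
end
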